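/- arXiv:0704.0608 — 4 statements merged into one kernel-verified Lean document; each statement's English description precedes it below -/
import Mathlib

section
/- Let (R,m) be a Cohen–Macaulay Noetherian local ring of dimension d ≥ 1 with infinite residue field, let I be an m-primary ideal with minimal reduction J = (a_1,…,a_d), where a_1,…,a_{d−1} form a superficial sequence for I. Set R' = R/(a_1,…,a_{d−1}), I' = IR', and let r = r_{(a_d)}(I') be the reduction number of I' with respect to (a_d). Then: (1) r < e_0(I), and I'^{n+1} = a_d I'^n for all n ≥ r; (2) λ(R'/I'^{r+1}) = e_0(I)(r+1) − e_1(I); and (3) e_1(I) = e_0(I)·r − λ(R'/I'^{r}). -/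
/-- The length of an `R`-module `M`: the Krull dimension of its lattice of submodules. -/
noncomputable def moduleLength (R M : Type*) [CommRing R] [AddCommGroup M] [Module R M] :
    WithBot ℕ∞ :=
  Order.krullDim (Submodule R M)

/-- A Noetherian local ring is Cohen–Macaulay if it admits a regular sequence contained in
the maximal ideal whose length equals its Krull dimension (i.e. depth R = dim R). -/
def IsCohenMacaulayLocalRing (R : Type*) [CommRing R] [IsLocalRing R] : Prop :=
  ∃ rs : List R, (∀ x ∈ rs, x ∈ IsLocalRing.maximalIdeal R) ∧
    RingTheory.Sequence.IsRegular R rs ∧ (rs.length : WithBot ℕ∞) = ringKrullDim R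

/-- `J` is a reduction of `I` : `J ⊆ I` and `I^(r+1) = J·I^r` for some `r ≥ 0`. -/
def Ideal.IsReductionOf {R : Type*} [CommRing R] (J I : Ideal R) : Prop :=
  J ≤ I ∧ ∃ r : ℕ, I ^ (r + 1) = J * I ^ r

/-- A reduction `J` of `I` is minimal if it contains no strictly smaller reduction of `I`. -/
def Ideal.IsMinimalReductionOf {R : Type*} [CommRing R] (J I : Ideal R) : Prop :=
  J.IsReductionOf I ∧ ∀ J' : Ideal R, J' ≤ J → J'.IsReductionOf I → J' = J

/-- `x` is a superficial element for `I` : `x ∈ I` and there is `c` with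
`(I^{n+1} : x) ∩ I^c = I^n` for all `n ≥ c`. -/
def IsSuperficial {R : Type*} [CommRing R] (I : Ideal R) (x : R) : Prop :=
  x ∈ I ∧ ∃ c : ℕ, ∀ n ≥ c, (I ^ (n + 1)).colon (Ideal.span {x}) ⊓ I ^ c = I ^ n

/-- `a_1,…,a_s` is a superficial sequence for `I` : each `a_i` is superficial for `I`
modulo `(a_1,…,a_{i−1})`. -/
def IsSuperficialSequence {R : Type*} [CommRing R] (I : Ideal R) {s : ℕ}
    (a : Fin s → R) : Prop :=
  ∀ i : Fin s,
    IsSuperficial (I.map (Ideal.Quotient.mk (Ideal.span (a '' {j | j < i}))))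
      (Ideal.Quotient.mk (Ideal.span (a '' {j | j < i})) (a i))

/-- `J` has Hilbert coefficients `e0, e1` (in dimension `n`):
`λ(R/J^m) = e0·C(m+n−1, n) − e1·C(m+n−2, n−1) + (lower order terms)` for `m ≫ 0`. -/
def HasHilbertCoefficients {R : Type*} [CommRing R] (J : Ideal R) (n : ℕ) (e0 e1 : ℚ) :
    Prop :=
  ∃ (ℓ : ℕ → ℕ) (P : Polynomial ℚ) (N : ℕ),
    (∀ m, moduleLength R (R ⧸ J ^ m) = (ℓ m : ℕ∞)) ∧
    P.degree < ((n - 1 : ℕ) : WithBot ℕ) ∧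
    ∀ m ≥ N, (ℓ m : ℚ) =
      e0 * ((m + n - 1).choose n : ℚ) - e1 * ((m + n - 2).choose (n - 1) : ℚ) +
        P.eval (m : ℚ)

universe u

open IsLocalRing RingTheory.Sequence CategoryTheory Abelian in
/-- Dividing out a regular element lowers the depth by at most one. -/
lemma exists_isRegular_quotSMulTop {R : Type u} [CommRing R] [IsLocalRing R] [IsNoetherianRing R]
    {M : Type u} [AddCommGroup M] [Module R M] [Module.Finite R M] {x : R}
    (hx : x ∈ maximalIdeal R) (hreg : IsSMulRegular M x) {n : ℕ}
    (h : ∃ rs : List R, rs.length = n + 1 ∧ (∀ y ∈ rs, y ∈ maximalIdeal R) ∧ IsRegular M rs) :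
    ∃ rs : List R, rs.length = n ∧ (∀ y ∈ rs, y ∈ maximalIdeal R) ∧
      IsRegular (QuotSMulTop x M) rs := by
  obtain ⟨rs, len, mem, reg⟩ := h
  have : Nontrivial M := reg.nontrivial
  have : Nontrivial (QuotSMulTop x M) := nontrivial_quotSMulTop_of_mem_maximalIdeal M hx
  have smul_lt (L : Type u) [AddCommGroup L] [Module R L] [Module.Finite R L] [Nontrivial L] :
      maximalIdeal R • (⊤ : Submodule R L) < ⊤ :=
    (Submodule.top_ne_ideal_smul_of_le_jacobson_annihilator
      (maximalIdeal_le_jacobson _)).symm.lt_top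
  have supp : Module.support R (ModuleCat.of R (R ⧸ maximalIdeal R)) =
      PrimeSpectrum.zeroLocus (maximalIdeal R) := by
    rw [Module.support_eq_zeroLocus, Ideal.annihilator_quotient]
  have ext_M := ModuleCat.subsingleton_ext_of_exists_isRegular (maximalIdeal R)
    (ModuleCat.of R (R ⧸ maximalIdeal R)) supp.subset (ModuleCat.of R M) (smul_lt M) rs mem reg
  refine ModuleCat.exists_isRegular_of_exists_subsingleton_ext (maximalIdeal R) n
    (ModuleCat.of R (QuotSMulTop x M)) (smul_lt _) (ModuleCat.of R (R ⧸ maximalIdeal R)) supp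
    fun i hi ↦ ?_
  have zero1 := AddCommGrpCat.isZero_of_iff_subsingleton.mpr (ext_M i (by omega))
  have zero2 := AddCommGrpCat.isZero_of_iff_subsingleton.mpr (ext_M (i + 1) (by omega))
  have hreg' : IsSMulRegular (ModuleCat.of R M) x := hreg
  exact AddCommGrpCat.subsingleton_of_isZero <| ShortComplex.Exact.isZero_of_both_zeros
    ((Ext.covariant_sequence_exact₃' _ hreg'.smulShortComplex_shortExact) i (i + 1) rfl)
    (zero1.eq_zero_of_src _) (zero2.eq_zero_of_tgt _)

/-- A superficial element for an ideal containing a nonzerodivisor is a nonzerodivisor. -/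
lemma IsSuperficial.eq_zero_of_mul_eq_zero {A : Type*} [CommRing A] [IsLocalRing A]
    [IsNoetherianRing A] {I : Ideal A} (hI : I ≠ ⊤) {x b : A} (hx : IsSuperficial I x)
    (hb : b ∈ I) (hbreg : b ∈ nonZeroDivisors A) {z : A} (hz : x * z = 0) : z = 0 := by
  obtain ⟨-, c, hc⟩ := hx
  have hmem : ∀ n, b ^ c * z ∈ I ^ n := by
    intro n
    refine Ideal.pow_le_pow_right (le_max_left n c) ?_
    rw [← hc (max n c) (le_max_right n c)]
    refine ⟨?_, Ideal.mul_mem_right _ _ (Ideal.pow_mem_pow hb c)⟩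
    rw [SetLike.mem_coe, Submodule.mem_colon_span_singleton]
    simp [mul_assoc, mul_comm z x, hz]
  have hzero : b ^ c * z = 0 := by
    have : b ^ c * z ∈ ⨅ n, I ^ n := by simpa [Submodule.mem_iInf] using hmem
    rwa [Ideal.iInf_pow_eq_bot_of_isLocalRing I hI] at this
  exact (mul_left_mem_nonZeroDivisors_eq_zero_iff (pow_mem hbreg c)).mp hzero

/-- For a superficial nonzerodivisor `x` of `I`, eventually `I ^ (n + 1) : x = I ^ n`. -/
lemma IsSuperficial.eventually_mem_pow {A : Type*} [CommRing A] [IsNoetherianRing A]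
    {I : Ideal A} {x : A} (hx : IsSuperficial I x) (hreg : ∀ z, x * z = 0 → z = 0) :
    ∃ N, ∀ n ≥ N, ∀ z, x * z ∈ I ^ (n + 1) ↔ z ∈ I ^ n := by
  obtain ⟨hxI, c, hc⟩ := hx
  obtain ⟨k, hk⟩ := Ideal.exists_pow_inf_eq_pow_smul (M := A) I (Ideal.span {x})
  refine ⟨c + k, fun n hn z ↦ ⟨fun hz ↦ ?_, fun hz ↦ ?_⟩⟩
  · rw [← hc n (by omega)]
    refine ⟨by rwa [SetLike.mem_coe, Submodule.mem_colon_span_singleton, smul_eq_mul, mul_comm], ?_⟩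
    have hmem : x * z ∈ I ^ (n + 1) • ⊤ ⊓ Ideal.span {x} :=
      ⟨by simpa using hz, Ideal.mem_span_singleton.mpr ⟨z, rfl⟩⟩
    rw [hk (n + 1) (by omega)] at hmem
    have hle : I ^ (n + 1 - k) • (I ^ k • ⊤ ⊓ Ideal.span {x}) ≤
        Ideal.span {x} * I ^ (n + 1 - k) := by
      rw [smul_eq_mul, mul_comm]
      exact Ideal.mul_mono_left inf_le_right
    obtain ⟨w, hw, hwz⟩ := Ideal.mem_span_singleton_mul.mp (hle hmem)
    have : w = z := sub_eq_zero.mp (hreg _ (by rw [mul_sub, hwz, sub_self]))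
    exact Ideal.pow_le_pow_right (by omega) (this ▸ hw)
  · rw [pow_succ']
    exact Ideal.mul_mem_mul hxI hz

/-- Additivity of length along `0 → R/(P : x) → R/P → R/(P + (x)) → 0`. -/
lemma length_quotient_eq_add {R : Type*} [CommRing R] {P Q : Ideal R} {x : R}
    (h : ∀ z, x * z ∈ P ↔ z ∈ Q) :
    Module.length R (R ⧸ P) =
      Module.length R (R ⧸ Q) + Module.length R (R ⧸ P ⊔ Ideal.span {x}) := by
  have hle : Q = Submodule.comap (LinearMap.mulLeft R x) P := by
    ext z
    exact (h z).symm
  refine Module.length_eq_add_of_exact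
    (Submodule.mapQ Q P (LinearMap.mulLeft R x) hle.le)
    (Submodule.factor le_sup_left) ?_ (Submodule.factor_surjective _) ?_
  · rw [← LinearMap.ker_eq_bot, Submodule.mapQ]
    refine Submodule.ker_liftQ_eq_bot _ _ _ ?_
    rw [LinearMap.ker_comp, Submodule.ker_mkQ]
    exact hle.ge
  · intro y
    obtain ⟨y, rfl⟩ := Submodule.Quotient.mk_surjective _ y
    constructor
    · intro hy
      rw [← Submodule.mkQ_apply, Submodule.factor_mk, Submodule.mkQ_apply,
        Submodule.Quotient.mk_eq_zero] at hy
      obtain ⟨p, hp, q, hq, rfl⟩ := Submodule.mem_sup.mp hy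
      obtain ⟨w, rfl⟩ := Ideal.mem_span_singleton.mp hq
      refine ⟨Submodule.Quotient.mk w, ?_⟩
      rw [Submodule.mapQ_apply]
      refine (Submodule.Quotient.eq _).mpr ?_
      simpa using hp
    · rintro ⟨w, hw⟩
      obtain ⟨w, rfl⟩ := Submodule.Quotient.mk_surjective _ w
      rw [Submodule.mapQ_apply] at hw
      rw [← hw, ← Submodule.mkQ_apply, Submodule.factor_mk, Submodule.mkQ_apply,
        Submodule.Quotient.mk_eq_zero]
      exact Ideal.mem_sup_right (Ideal.mem_span_singleton.mpr ⟨w, rfl⟩)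

lemma length_quotient_map_mk {R : Type*} [CommRing R] (K I : Ideal R) :
    Module.length (R ⧸ K) ((R ⧸ K) ⧸ I.map (Ideal.Quotient.mk K)) =
      Module.length R (R ⧸ I ⊔ K) := by
  rw [← Module.length_eq_of_surjective (S := R) (R := R ⧸ K) Ideal.Quotient.mk_surjective, sup_comm]
  exact (DoubleQuot.quotQuotEquivQuotSupₐ R K I).toLinearEquiv.length_eq

/-- Lengths of cyclic modules strictly decrease along strict inclusions of ideals. -/
lemma length_quotient_add_one_le {R : Type*} [CommRing R] {K L : Ideal R} (h : K < L) :
    Module.length R (R ⧸ L) + 1 ≤ Module.length R (R ⧸ K) := by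
  rw [Module.length_quotient, Module.length_quotient]
  exact Order.coheight_add_one_le h

/-- The quotient of `R ⧸ K` by `x` is `R ⧸ K ⊔ (x)`. -/
noncomputable def quotSMulTopQuotientEquiv {R : Type*} [CommRing R] (K : Ideal R) (x : R) :
    QuotSMulTop x (R ⧸ K) ≃ₗ[R] R ⧸ K ⊔ Ideal.span {x} :=
  (Submodule.quotEquivOfEq _ _ <| by
    ext y
    obtain ⟨y, rfl⟩ := Submodule.Quotient.mk_surjective _ y
    rw [LinearMap.mem_ker, ← Submodule.mkQ_apply, Submodule.factor_mk, Submodule.mkQ_apply,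
      Submodule.mkQ_apply, Submodule.Quotient.mk_eq_zero, Submodule.mem_smul_pointwise_iff_exists]
    constructor
    · rintro ⟨w, -, hw⟩
      obtain ⟨w, rfl⟩ := Submodule.Quotient.mk_surjective _ w
      have hw : (Submodule.Quotient.mk (x • w) : R ⧸ K) = Submodule.Quotient.mk y := hw
      rw [Submodule.Quotient.eq] at hw
      rw [sup_comm]
      refine Submodule.mem_sup.mpr ⟨x * w, Ideal.mem_span_singleton.mpr ⟨w, rfl⟩,
        y - x * w, by simpa using K.neg_mem hw, by ring⟩
    · intro hy
      obtain ⟨p, hp, q, hq, rfl⟩ := Submodule.mem_sup.mp hy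
      obtain ⟨w, rfl⟩ := Ideal.mem_span_singleton.mp hq
      refine ⟨Submodule.Quotient.mk w, trivial, ?_⟩
      change (Submodule.Quotient.mk (x • w) : R ⧸ K) = Submodule.Quotient.mk (p + x * w)
      refine (Submodule.Quotient.eq _).mpr ?_
      simpa using hp).trans
  (LinearMap.quotKerEquivOfSurjective
    (Submodule.factor (le_sup_left : K ≤ K ⊔ Ideal.span {x})) (Submodule.factor_surjective _))

/-- `f` eventually agrees with a polynomial of degree at most `n` whose two leading coefficients
in the binomial basis are `e0` and `-e1`. -/
def IsHilbertFunction (f : ℕ → ℕ∞) (n : ℕ) (e0 e1 : ℚ) : Prop :=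
  ∃ (ℓ : ℕ → ℕ) (P : Polynomial ℚ) (N : ℕ),
    (∀ m, f m = ℓ m) ∧ P.degree < ((n - 1 : ℕ) : WithBot ℕ) ∧
    ∀ m ≥ N, (ℓ m : ℚ) =
      e0 * ((m + n - 1).choose n : ℚ) - e1 * ((m + n - 2).choose (n - 1) : ℚ) +
        P.eval (m : ℚ)

lemma hasHilbertCoefficients_iff {R : Type*} [CommRing R] {J : Ideal R} {n : ℕ} {e0 e1 : ℚ} :
    HasHilbertCoefficients J n e0 e1 ↔
      IsHilbertFunction (fun m ↦ Module.length R (R ⧸ J ^ m)) n e0 e1 := by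
  simp only [HasHilbertCoefficients, IsHilbertFunction, moduleLength, ← Module.coe_length,
    WithBot.coe_inj]

lemma Polynomial.degree_sub_taylor_lt {P : Polynomial ℚ} {n : ℕ} (c : ℚ)
    (hP : P.degree < ((n + 1 : ℕ) : WithBot ℕ)) :
    (P - Polynomial.taylor c P).degree < (n : WithBot ℕ) := by
  by_cases h0 : P = 0
  · simp [h0]
  have hlt := Polynomial.degree_sub_lt_left (Polynomial.degree_taylor P c).symm h0
    (by simp)
  refine hlt.trans_le ?_
  rw [Polynomial.degree_eq_natDegree h0] at hP ⊢
  have : P.natDegree < n + 1 := by exact_mod_cast hP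
  exact_mod_cast (by omega : P.natDegree ≤ n)

/-- The first difference of a Hilbert function has the same leading binomial coefficients. -/
lemma IsHilbertFunction.of_difference {f g : ℕ → ℕ∞} {n : ℕ} {e0 e1 : ℚ}
    (hf : IsHilbertFunction f (n + 2) e0 e1) (hg : ∀ m, g m ≤ f m)
    (h : ∃ N, ∀ m ≥ N, f (m + 1) = f m + g (m + 1)) :
    IsHilbertFunction g (n + 1) e0 e1 := by
  obtain ⟨ℓ, P, N, hℓ, hP, hform⟩ := hf
  obtain ⟨N', hN'⟩ := h
  have hfin : ∀ m, ∃ k : ℕ, g m = k := fun m ↦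
    (ENat.ne_top_iff_exists.mp ((hg m).trans_lt (hℓ m ▸ ENat.natCast_lt_top _)).ne).imp
      fun _ ↦ Eq.symm
  choose k hk using hfin
  refine ⟨k, P - Polynomial.taylor (-1) P, N + N' + 1, hk,
    Polynomial.degree_sub_taylor_lt _ hP, fun m hm ↦ ?_⟩
  obtain ⟨m, rfl⟩ : ∃ j, m = j + 1 := ⟨m - 1, by omega⟩
  have hrec : ℓ (m + 1) = ℓ m + k (m + 1) := by
    have := hN' m (by omega)
    rw [hℓ, hℓ, hk] at this
    exact_mod_cast this
  have h1 := hform m (by omega)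
  have h2 := hform (m + 1) (by omega)
  have h3 : (ℓ (m + 1) : ℚ) = ℓ m + k (m + 1) := by exact_mod_cast hrec
  rw [show m + (n + 2) - 1 = m + n + 1 by omega, show m + (n + 2) - 2 = m + n by omega,
    show n + 2 - 1 = n + 1 by omega] at h1
  rw [show m + 1 + (n + 2) - 1 = m + n + 1 + 1 by omega,
    show m + 1 + (n + 2) - 2 = m + n + 1 by omega, show n + 2 - 1 = n + 1 by omega,
    show (m + n + 1 + 1).choose (n + 2) = (m + n + 1).choose (n + 1) + (m + n + 1).choose (n + 2)
      from Nat.choose_succ_succ _ _,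
    Nat.cast_add ((m + n + 1).choose (n + 1)),
    show (m + n + 1).choose (n + 1) = (m + n).choose n + (m + n).choose (n + 1)
      from Nat.choose_succ_succ _ _] at h2
  rw [show m + 1 + (n + 1) - 1 = m + n + 1 by omega, show m + 1 + (n + 1) - 2 = m + n by omega,
    show n + 1 - 1 = n by omega, Polynomial.eval_sub, Polynomial.taylor_eval,
    show (m + n + 1).choose (n + 1) = (m + n).choose n + (m + n).choose (n + 1)
      from Nat.choose_succ_succ _ _]
  rw [show ((m + 1 : ℕ) : ℚ) + -1 = m by push_cast; ring]
  push_cast at h1 h2 ⊢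
  linarith

open IsLocalRing in
lemma map_mk_le_maximalIdeal {R : Type*} [CommRing R] [IsLocalRing R] {I K : Ideal R}
    [IsLocalRing (R ⧸ K)] (hI : I ≤ maximalIdeal R) :
    I.map (Ideal.Quotient.mk K) ≤ maximalIdeal (R ⧸ K) :=
  have : IsLocalHom (Ideal.Quotient.mk K) := .of_surjective _ Ideal.Quotient.mk_surjective
  (Ideal.map_mono hI).trans (((local_hom_TFAE (Ideal.Quotient.mk K)).out 0 2).mp this)

open IsLocalRing RingTheory.Sequence in
/-- Dividing out a superficial element, while the depth is positive, lowers the dimension in the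
Hilbert function by one without changing `e0` and `e1`. -/
lemma IsHilbertFunction.sup_span_singleton {R : Type u} [CommRing R] [IsLocalRing R]
    [IsNoetherianRing R] {I K : Ideal R} {x : R} {n : ℕ} {e0 e1 : ℚ}
    (hI : I.radical = maximalIdeal R) (hxI : x ∈ I)
    (hx : IsSuperficial (I.map (Ideal.Quotient.mk K)) (Ideal.Quotient.mk K x))
    (hdepth : ∃ rs : List R, rs.length = n + 2 ∧ (∀ y ∈ rs, y ∈ maximalIdeal R) ∧
      IsRegular (R ⧸ K) rs)
    (hH : IsHilbertFunction (fun m ↦ Module.length R (R ⧸ I ^ m ⊔ K)) (n + 2) e0 e1) :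
    (∃ rs : List R, rs.length = n + 1 ∧ (∀ y ∈ rs, y ∈ maximalIdeal R) ∧
      IsRegular (R ⧸ K ⊔ Ideal.span {x}) rs) ∧
    IsHilbertFunction (fun m ↦ Module.length R (R ⧸ I ^ m ⊔ (K ⊔ Ideal.span {x})))
      (n + 1) e0 e1 := by
  obtain ⟨rs, hlen, hmem, hrs⟩ := hdepth
  have hIm : I ≤ maximalIdeal R := hI ▸ Ideal.le_radical
  have hnt : Nontrivial (R ⧸ K) := hrs.nontrivial
  have : IsLocalRing (R ⧸ K) := .of_surjective' _ Ideal.Quotient.mk_surjective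
  have hI' : I.map (Ideal.Quotient.mk K) ≠ ⊤ :=
    ne_top_of_le_ne_top (maximalIdeal.isMaximal _).ne_top (map_mk_le_maximalIdeal hIm)
  have hregx : ∀ z, Ideal.Quotient.mk K x * z = 0 → z = 0 := by
    obtain ⟨b, rs', rfl⟩ : ∃ b rs', rs = b :: rs' := by
      cases rs with
      | nil => simp at hlen
      | cons b rs' => exact ⟨b, rs', rfl⟩
    rw [isRegular_cons_iff] at hrs
    obtain ⟨j, hj⟩ : b ∈ I.radical := hI ▸ hmem b (by simp)
    have hbreg : Ideal.Quotient.mk K b ∈ nonZeroDivisors (R ⧸ K) := by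
      rw [mem_nonZeroDivisors_iff_right]
      intro z hz
      refine hrs.1.right_eq_zero_of_smul ?_
      rw [Algebra.smul_def, mul_comm]
      exact hz
    refine fun z ↦ hx.eq_zero_of_mul_eq_zero hI' (Ideal.mem_map_of_mem _ hj) ?_
    rw [map_pow]
    exact pow_mem hbreg j
  refine ⟨?_, ?_⟩
  · have hsmul : IsSMulRegular (R ⧸ K) x := by
      rw [isSMulRegular_iff_right_eq_zero_of_smul]
      intro z hz
      refine hregx z ?_
      rw [Algebra.smul_def] at hz
      exact hz
    obtain ⟨rs', h1, h2, h3⟩ :=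
      exists_isRegular_quotSMulTop (hIm hxI) hsmul ⟨rs, hlen, hmem, hrs⟩
    exact ⟨rs', h1, h2, ((quotSMulTopQuotientEquiv K x).isRegular_congr rs').mp h3⟩
  · refine hH.of_difference (fun m ↦ ?_) ?_
    · exact Module.length_le_of_surjective
        (Submodule.factor (sup_le_sup_left le_sup_left _)) (Submodule.factor_surjective _)
    · obtain ⟨N, hN⟩ := hx.eventually_mem_pow hregx
      refine ⟨N, fun m hm ↦ ?_⟩
      have hmk : ∀ (k : ℕ) (z : R), Ideal.Quotient.mk K z ∈ I.map (Ideal.Quotient.mk K) ^ k ↔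
          z ∈ I ^ k ⊔ K := by
        intro k z
        rw [← Ideal.map_pow, ← Ideal.mem_comap,
          Ideal.comap_map_of_surjective' _ Ideal.Quotient.mk_surjective, Ideal.mk_ker]
      have key : ∀ z, x * z ∈ I ^ (m + 1) ⊔ K ↔ z ∈ I ^ m ⊔ K := by
        intro z
        rw [← hmk, ← hmk, map_mul, hN m hm]
      have hlength := length_quotient_eq_add key
      rwa [sup_assoc] at hlength

lemma Ideal.le_of_span_singleton_mul_le {A : Type*} [CommRing A] {a : A}
    (ha : ∀ z, a * z = 0 → z = 0) {X Y : Ideal A}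
    (h : Ideal.span {a} * Y ≤ Ideal.span {a} * X) : Y ≤ X := by
  intro y hy
  obtain ⟨x, hx, hxy⟩ := Ideal.mem_span_singleton_mul.mp
    (h (Ideal.mul_mem_mul (Ideal.mem_span_singleton_self a) hy))
  rwa [← sub_eq_zero.mp (ha (x - y) (by rw [mul_sub, hxy, sub_self]))]

open IsLocalRing in
/-- If `(a)` is a reduction of `I` with reduction number `r`, generated by a nonzerodivisor, the
ideals `a ^ k I ^ n + m I ^ r` with `n + k = r` are strictly increasing in `n`. -/
lemma pow_mul_pow_sup_lt {A : Type*} [CommRing A] [IsLocalRing A] [IsNoetherianRing A]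
    {I : Ideal A} {a : A} (ha : a ∈ I) (hreg : ∀ z, a * z = 0 → z = 0) {r : ℕ}
    (hr : I ^ (r + 1) = Ideal.span {a} * I ^ r)
    (hrleast : ∀ r' : ℕ, I ^ (r' + 1) = Ideal.span {a} * I ^ r' → r ≤ r')
    {n k : ℕ} (hnk : n + 1 + k = r) :
    Ideal.span {a} ^ (k + 1) * I ^ n ⊔ maximalIdeal A * I ^ r <
      Ideal.span {a} ^ k * I ^ (n + 1) ⊔ maximalIdeal A * I ^ r := by
  have haI : Ideal.span {a} ≤ I := (Ideal.span_singleton_le_iff_mem I).mpr ha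
  refine lt_of_le_not_ge (sup_le_sup_right ?_ _) fun hle ↦ ?_
  · rw [pow_succ, pow_succ', mul_assoc]
    exact Ideal.mul_mono_right (Ideal.mul_mono_left haI)
  set X := Ideal.span {a} ^ (k + 1) * I ^ n ⊔ maximalIdeal A * I ^ r with hX
  have hk : Ideal.span {a} ^ k * I ^ (n + 1) ≤ X := le_sup_left.trans hle
  have descend : ∀ i j, i + j = k → Ideal.span {a} ^ j * I ^ (n + 1 + i) ≤ X := by
    intro i
    induction i with
    | zero =>
      rintro j hj
      obtain rfl : j = k := by omega
      exact hk
    | succ i ih =>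
      intro j hj
      refine Ideal.le_of_span_singleton_mul_le hreg ?_
      calc Ideal.span {a} * (Ideal.span {a} ^ j * I ^ (n + 1 + (i + 1)))
          = I * (Ideal.span {a} ^ (j + 1) * I ^ (n + 1 + i)) := by ring
        _ ≤ I * X := Ideal.mul_mono_right (ih (j + 1) (by omega))
        _ = Ideal.span {a} * (Ideal.span {a} ^ k * I ^ (n + 1)) ⊔
              maximalIdeal A * I ^ (r + 1) := by
            rw [hX, Ideal.mul_sup]
            congr 1 <;> ring
        _ = Ideal.span {a} * (Ideal.span {a} ^ k * I ^ (n + 1) ⊔ maximalIdeal A * I ^ r) := by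
            rw [hr, Ideal.mul_sup]
            congr 1
            ring
        _ ≤ Ideal.span {a} * X := Ideal.mul_mono_right (sup_le hk le_sup_right)
  have hIr : I ^ r ≤ Ideal.span {a} ^ (k + 1) * I ^ n := by
    refine Submodule.le_of_le_smul_of_le_jacobson_bot (I := maximalIdeal A)
      (IsNoetherian.noetherian _) (maximalIdeal_le_jacobson _) ?_
    have := descend k 0 (by omega)
    rwa [pow_zero, Ideal.one_eq_top, Ideal.top_mul, hnk] at this
  have : r ≤ n + k := by
    refine hrleast _ (le_antisymm ?_ ?_)
    · rw [show n + k + 1 = r by omega]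
      refine hIr.trans ?_
      rw [pow_succ', mul_assoc, add_comm n k, pow_add]
      exact Ideal.mul_mono_right (Ideal.mul_mono_left (Ideal.pow_right_mono haI k))
    · rw [pow_succ']
      exact Ideal.mul_mono_left haI
  omega

open IsLocalRing in
/-- Going up from the reduction number `r`, the length jumps by at least `r + 1`. -/
lemma length_quotient_pow_add_le {A : Type*} [CommRing A] [IsLocalRing A] [IsNoetherianRing A]
    {I : Ideal A} (hI : I ≤ maximalIdeal A) {a : A} (ha : a ∈ I)
    (hreg : ∀ z, a * z = 0 → z = 0) {r : ℕ}
    (hr : I ^ (r + 1) = Ideal.span {a} * I ^ r)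
    (hrleast : ∀ r' : ℕ, I ^ (r' + 1) = Ideal.span {a} * I ^ r' → r ≤ r') :
    Module.length A (A ⧸ I ^ r) + (r + 1 : ℕ) ≤ Module.length A (A ⧸ I ^ (r + 1)) := by
  have haI : Ideal.span {a} ≤ I := (Ideal.span_singleton_le_iff_mem I).mpr ha
  have chain : ∀ k n, n + k = r → Module.length A (A ⧸ I ^ r) + k ≤
      Module.length A (A ⧸ Ideal.span {a} ^ k * I ^ n ⊔ maximalIdeal A * I ^ r) := by
    intro k
    induction k with
    | zero =>
      rintro n rfl
      rw [Nat.cast_zero, add_zero]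
      refine Module.length_le_of_surjective (Submodule.factor (sup_le ?_ Ideal.mul_le_right))
        (Submodule.factor_surjective _)
      simp
    | succ k ih =>
      intro n hn
      calc _ = Module.length A (A ⧸ I ^ r) + k + 1 := by push_cast; rw [add_assoc]
        _ ≤ _ := add_le_add_left (ih (n + 1) (by omega)) 1
        _ ≤ _ := length_quotient_add_one_le
          (pow_mul_pow_sup_lt ha hreg hr hrleast (by omega))
  have hnot : ¬ Ideal.span {a} ^ r ≤ maximalIdeal A * I ^ r := by
    intro h
    have hpow : ∀ j, I ^ (r + j) = Ideal.span {a} ^ j * I ^ r := by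
      intro j
      induction j with
      | zero => simp
      | succ j ih =>
        rw [← add_assoc, pow_succ, ih, mul_assoc, ← pow_succ, hr, ← mul_assoc, ← pow_succ]
    have hbot : I ^ (r + r) = ⊥ := by
      refine Submodule.eq_bot_of_le_smul_of_le_jacobson_bot (maximalIdeal A) _
        (IsNoetherian.noetherian _) ?_ (maximalIdeal_le_jacobson _)
      calc I ^ (r + r) = Ideal.span {a} ^ r * I ^ r := hpow r
        _ ≤ maximalIdeal A * I ^ r * I ^ r := Ideal.mul_mono_left h
        _ = maximalIdeal A • I ^ (r + r) := by rw [smul_eq_mul, mul_assoc, pow_add]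
    have hazero : a ^ (r + r) = 0 := by
      rw [← Ideal.mem_bot, ← hbot]
      exact Ideal.pow_mem_pow ha _
    have hane : a ∈ nonZeroDivisors A :=
      mem_nonZeroDivisors_iff_left.mpr fun z hz ↦ hreg z hz
    exact nonZeroDivisors.ne_zero (pow_mem hane (r + r)) hazero
  have hlt : maximalIdeal A * I ^ r <
      Ideal.span {a} ^ r * I ^ 0 ⊔ maximalIdeal A * I ^ r := by
    refine lt_of_le_not_ge le_sup_right fun hle ↦ hnot ?_
    simpa using le_sup_left.trans hle
  calc Module.length A (A ⧸ I ^ r) + (r + 1 : ℕ)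
      = Module.length A (A ⧸ I ^ r) + r + 1 := by push_cast; rw [add_assoc]
    _ ≤ _ := add_le_add_left (chain r 0 (by omega)) 1
    _ ≤ Module.length A (A ⧸ maximalIdeal A * I ^ r) := length_quotient_add_one_le hlt
    _ ≤ _ := Module.length_le_of_surjective
      (Submodule.factor (by rw [pow_succ']; exact Ideal.mul_mono_left hI))
      (Submodule.factor_surjective _)

open IsLocalRing in
/-- The one-dimensional case: `(a)` is a reduction of `I` with reduction number `r`, generated by
a nonzerodivisor. -/
lemma reductionNumber_lt_and_length_eq {A : Type*} [CommRing A] [IsLocalRing A]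
    [IsNoetherianRing A] {I : Ideal A} (hI : I ≤ maximalIdeal A) {a : A} (ha : a ∈ I)
    (hreg : ∀ z, a * z = 0 → z = 0) {r : ℕ}
    (hr : I ^ (r + 1) = Ideal.span {a} * I ^ r)
    (hrleast : ∀ r' : ℕ, I ^ (r' + 1) = Ideal.span {a} * I ^ r' → r ≤ r')
    {e0 e1 : ℚ} (hH : IsHilbertFunction (fun m ↦ Module.length A (A ⧸ I ^ m)) 1 e0 e1) :
    ((r : ℚ) < e0 ∧ ∀ n ≥ r, I ^ (n + 1) = Ideal.span {a} * I ^ n) ∧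
      ∀ n ≥ r, ∃ ℓ : ℕ, Module.length A (A ⧸ I ^ n) = ℓ ∧ (ℓ : ℚ) = e0 * n - e1 := by
  obtain ⟨ℓ, P, N, hℓ, hP, hform⟩ := hH
  beta_reduce at hℓ
  have hstable : ∀ n ≥ r, I ^ (n + 1) = Ideal.span {a} * I ^ n := by
    intro n hn
    induction n, hn using Nat.le_induction with
    | base => exact hr
    | succ n _ ih => rw [pow_succ, ih, mul_assoc, ← pow_succ, ih]
  have hstep : ∀ n ≥ r, Module.length A (A ⧸ I ^ (n + 1)) =
      Module.length A (A ⧸ I ^ n) + Module.length A (A ⧸ Ideal.span {a}) := by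
    intro n hn
    have hcolon : ∀ z, a * z ∈ I ^ (n + 1) ↔ z ∈ I ^ n := by
      intro z
      rw [hstable n hn, Ideal.mem_span_singleton_mul]
      constructor
      · rintro ⟨w, hw, hwz⟩
        rwa [← sub_eq_zero.mp (hreg (w - z) (by rw [mul_sub, hwz, sub_self]))]
      · exact fun hz ↦ ⟨z, hz, rfl⟩
    have := length_quotient_eq_add hcolon
    rwa [sup_eq_right.mpr (hstable n hn ▸ Ideal.mul_le_left)] at this
  obtain ⟨c, hc⟩ : ∃ c : ℕ, Module.length A (A ⧸ Ideal.span {a}) = c := by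
    have : Module.length A (A ⧸ Ideal.span {a}) ≤ (ℓ (r + 1) : ℕ∞) := by
      rw [← hℓ, hstep r le_rfl]
      exact le_add_self
    exact (ENat.ne_top_iff_exists.mp (this.trans_lt (ENat.natCast_lt_top _)).ne).imp
      fun _ ↦ Eq.symm
  have hrec : ∀ n ≥ r, ℓ (n + 1) = ℓ n + c := by
    intro n hn
    have := hstep n hn
    rw [hℓ, hℓ, hc] at this
    exact_mod_cast this
  have hrc : r + 1 ≤ c := by
    have := length_quotient_pow_add_le hI ha hreg hr hrleast
    rw [hℓ, hℓ, hrec r le_rfl] at this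
    have : ℓ r + (r + 1) ≤ ℓ r + c := by exact_mod_cast this
    omega
  have hP0 : P = 0 := by
    rw [← Polynomial.degree_eq_bot]
    simpa using hP
  have hlinear : ∀ m ≥ N, (ℓ m : ℚ) = e0 * m - e1 := by
    intro m hm
    simpa [hP0] using hform m hm
  have hexact : ∀ n ≥ r, (ℓ n : ℚ) = ℓ r + c * (n - r) := by
    intro n hn
    induction n, hn using Nat.le_induction with
    | base => simp
    | succ n hn ih =>
      rw [hrec n hn]
      push_cast
      rw [ih]
      ring
  have h1 := hexact (N + r) (by omega)
  have h2 := hexact (N + r + 1) (by omega)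
  rw [hlinear _ (by omega)] at h1 h2
  push_cast at h1 h2
  have he0 : e0 = c := by linarith
  refine ⟨⟨?_, hstable⟩, fun n hn ↦ ⟨ℓ n, hℓ n, ?_⟩⟩
  · rw [he0]
    exact_mod_cast hrc
  · rw [hexact n hn]
    subst he0
    linarith

lemma IsSuperficialSequence.isSuperficial_of_eq {R : Type*} [CommRing R] {I : Ideal R} {s : ℕ}
    {a : Fin s → R} (h : IsSuperficialSequence I a) (i : Fin s) {K : Ideal R}
    (hK : K = Ideal.span (a '' {j | j < i})) :
    IsSuperficial (I.map (Ideal.Quotient.mk K)) (Ideal.Quotient.mk K (a i)) := by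
  subst hK
  exact h i

/-- Let `(R,m)` be a Cohen–Macaulay Noetherian local ring of dimension
`d ≥ 1` with infinite residue field, let `I` be an `m`-primary ideal with minimal
reduction `J = (a_1,…,a_d)`, where `a_1,…,a_{d−1}` form a superficial sequence for `I`.
Set `R' = R/(a_1,…,a_{d−1})`, `I' = IR'`, and let `r = r_{(a_d)}(I')` be the reduction
number of `I'` with respect to `(a_d)`.  Then: (1) `r < e_0(I)`, and `I'^{n+1} = a_d·I'^n`
for all `n ≥ r`; (2) `λ(R'/I'^{r+1}) = e_0(I)·(r+1) − e_1(I)`; and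
(3) `e_1(I) = e_0(I)·r − λ(R'/I'^{r})`. -/
theorem chern_coefficient_via_reduction_number
    {R : Type*} [CommRing R] [IsLocalRing R] [IsNoetherianRing R]
    [Infinite (IsLocalRing.ResidueField R)]
    (hCM : IsCohenMacaulayLocalRing R) (d : ℕ) (hd : 1 ≤ d)
    (hdim : ringKrullDim R = d)
    (I : Ideal R) (hI : I.radical = IsLocalRing.maximalIdeal R)
    (a : Fin d → R) (J : Ideal R) (hJ : J = Ideal.span (Set.range a))
    (hJred : J.IsMinimalReductionOf I)
    (hsup : IsSuperficialSequence I (fun i : Fin (d - 1) => a (Fin.castLE (by omega) i)))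
    (Jpre : Ideal R) (hJpre : Jpre = Ideal.span (a '' {i | (i : ℕ) < d - 1}))
    (I' : Ideal (R ⧸ Jpre)) (hI' : I' = I.map (Ideal.Quotient.mk Jpre))
    (ad : R ⧸ Jpre) (had : ad = Ideal.Quotient.mk Jpre (a ⟨d - 1, by omega⟩))
    -- `r` is the reduction number of `I'` with respect to `(a_d)`
    (r : ℕ) (hr : I' ^ (r + 1) = Ideal.span {ad} * I' ^ r)
    (hrleast : ∀ r' : ℕ, I' ^ (r' + 1) = Ideal.span {ad} * I' ^ r' → r ≤ r') :
    ∀ e0 e1 : ℚ, HasHilbertCoefficients I d e0 e1 →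
      ((r : ℚ) < e0 ∧ ∀ n ≥ r, I' ^ (n + 1) = Ideal.span {ad} * I' ^ n) ∧
      (∃ ℓ : ℕ, moduleLength (R ⧸ Jpre) ((R ⧸ Jpre) ⧸ I' ^ (r + 1)) = (ℓ : ℕ∞) ∧
        (ℓ : ℚ) = e0 * (r + 1) - e1) ∧
      (∃ ℓ : ℕ, moduleLength (R ⧸ Jpre) ((R ⧸ Jpre) ⧸ I' ^ r) = (ℓ : ℕ∞) ∧
        e1 = e0 * (r : ℚ) - (ℓ : ℚ)) := by
  intro e0 e1 hH
  have hIm : I ≤ IsLocalRing.maximalIdeal R := hI ▸ Ideal.le_radical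
  have haI : ∀ i, a i ∈ I := fun i ↦
    hJred.1.1 (hJ ▸ Ideal.subset_span (Set.mem_range_self i))
  have htower : ∀ i n, i + (n + 1) = d →
      (∃ rs : List R, rs.length = n + 1 ∧ (∀ y ∈ rs, y ∈ IsLocalRing.maximalIdeal R) ∧
        RingTheory.Sequence.IsRegular (R ⧸ Ideal.span (a '' {j | (j : ℕ) < i})) rs) ∧
      IsHilbertFunction
        (fun m ↦ Module.length R (R ⧸ I ^ m ⊔ Ideal.span (a '' {j | (j : ℕ) < i})))
        (n + 1) e0 e1 := by
    intro i
    induction i with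
    | zero =>
      intro n hn
      have hbot : Ideal.span (a '' {j | (j : ℕ) < 0}) = ⊥ := by simp
      rw [hbot]
      refine ⟨?_, ?_⟩
      · obtain ⟨rs, hmem, hrs, hlen⟩ := hCM
        refine ⟨rs, ?_, hmem,
          ((Submodule.quotEquivOfEqBot (⊥ : Ideal R) rfl).isRegular_congr rs).mpr hrs⟩
        rw [hdim] at hlen
        have : rs.length = d := by exact_mod_cast hlen
        omega
      · rw [show n + 1 = d by omega]
        convert hasHilbertCoefficients_iff.mp hH using 2 with m
        rw [sup_bot_eq]
    | succ i ih =>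
      intro n hn
      obtain ⟨hdepth, hHi⟩ := ih (n + 1) (by omega)
      have himage : (fun j : Fin (d - 1) ↦ a (Fin.castLE (by omega) j)) ''
          {j | j < ⟨i, by omega⟩} = a '' {j | (j : ℕ) < i} := by
        ext y
        constructor
        · rintro ⟨j, hj, rfl⟩
          exact ⟨_, hj, rfl⟩
        · rintro ⟨j, hj, rfl⟩
          have hj : (j : ℕ) < i := hj
          exact ⟨⟨j, by omega⟩, hj, rfl⟩
      have hsupi := hsup.isSuperficial_of_eq ⟨i, by omega⟩ (congrArg Ideal.span himage).symm
      have hspan : Ideal.span (a '' {j | (j : ℕ) < i + 1}) =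
          Ideal.span (a '' {j | (j : ℕ) < i}) ⊔ Ideal.span {a ⟨i, by omega⟩} := by
        rw [← Ideal.span_union, ← Set.image_singleton, ← Set.image_union]
        congr 2
        ext j
        simp only [Set.mem_ofPred_eq, Set.mem_union, Set.mem_singleton_iff, Fin.ext_iff]
        omega
      rw [hspan]
      exact hHi.sup_span_singleton hI (haI _) hsupi hdepth
  obtain ⟨⟨rs, hlen, hmem, hrs⟩, hH'⟩ := htower (d - 1) 0 (by omega)
  rw [← hJpre] at hrs hH'
  have hnt : Nontrivial (R ⧸ Jpre) := hrs.nontrivial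
  have hloc : IsLocalRing (R ⧸ Jpre) := .of_surjective' _ Ideal.Quotient.mk_surjective
  have hI'm : I' ≤ IsLocalRing.maximalIdeal (R ⧸ Jpre) := hI' ▸ map_mk_le_maximalIdeal hIm
  have hadI' : ad ∈ I' := by
    rw [hI', had]
    exact Ideal.mem_map_of_mem _ (haI _)
  have hreg : ∀ z, ad * z = 0 → z = 0 := by
    obtain ⟨b, rfl⟩ := List.length_eq_one_iff.mp hlen
    rw [RingTheory.Sequence.isRegular_cons_iff] at hrs
    obtain ⟨j, hj⟩ : b ∈ I.radical := hI ▸ hmem b (by simp)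
    have hbpow : (Ideal.Quotient.mk Jpre b ^ j) ^ (r + 1) ∈ I' ^ (r + 1) := by
      rw [← map_pow, hI']
      exact Ideal.pow_mem_pow (Ideal.mem_map_of_mem _ hj) _
    rw [hr] at hbpow
    obtain ⟨w, hw⟩ := Ideal.mem_span_singleton.mp (Ideal.mul_le_left hbpow)
    intro z hz
    refine ((hrs.1.pow j).pow (r + 1)).right_eq_zero_of_smul ?_
    rw [Algebra.smul_def, Ideal.Quotient.algebraMap_eq, map_pow, map_pow, hw, mul_right_comm, hz,
      zero_mul]
  have hH'' : IsHilbertFunction (fun m ↦ Module.length (R ⧸ Jpre) ((R ⧸ Jpre) ⧸ I' ^ m))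
      1 e0 e1 := by
    convert hH' using 2 with m
    rw [hI', ← Ideal.map_pow, length_quotient_map_mk]
  obtain ⟨hfirst, hlength⟩ :=
    reductionNumber_lt_and_length_eq hI'm hadI' hreg hr hrleast hH''
  refine ⟨hfirst, ?_, ?_⟩
  · obtain ⟨ℓ, h1, h2⟩ := hlength (r + 1) (by omega)
    refine ⟨ℓ, ?_, by rw [h2]; push_cast; ring⟩
    rw [moduleLength, ← Module.coe_length, h1]
  · obtain ⟨ℓ, h1, h2⟩ := hlength r le_rfl
    refine ⟨ℓ, ?_, by rw [h2]; ring⟩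
    rw [moduleLength, ← Module.coe_length, h1]
end

section
/- Let (R,m) be a Gorenstein Noetherian local ring and let I be an m-primary ideal. Let J ⊆ I be an ideal generated by a system of parameters and set E = (J :_R I)/J, the canonical module of R/I. If E is generated as an R-module by nonzero elements e_1,…,e_r, and I_i = ann_R(e_i) for each i, then each I_i is an irreducible ideal and I = ⋂_{i=1}^r I_i. -/
lemma Submodule.length_quotient_anti {R M : Type*} [Ring R] [AddCommGroup M] [Module R M]
    {A B : Submodule R M} (h : A ≤ B) : Module.length R (M ⧸ B) ≤ Module.length R (M ⧸ A) :=
  Module.length_le_of_surjective (factor h) (factor_surjective h)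

/-- Passing from a submodule to one covering it lowers the length of the quotient by one. -/
lemma CovBy.length_quotient_eq_add_one {R M : Type*} [Ring R] [AddCommGroup M] [Module R M]
    {A B : Submodule R M} (h : A ⋖ B) :
    Module.length R (M ⧸ A) = Module.length R (M ⧸ B) + 1 := by
  have hs : IsSimpleModule R (B ⧸ A.comap B.subtype) := (covBy_iff_quot_is_simple h.le).mp h
  have hf : Function.Injective (Submodule.mapQ (A.comap B.subtype) A B.subtype le_rfl) := by
    rw [← LinearMap.ker_eq_bot]
    exact Submodule.ker_liftQ_eq_bot _ _ _ (by simp [LinearMap.ker_comp])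
  rw [Module.length_eq_add_of_exact (Submodule.mapQ (A.comap B.subtype) A B.subtype le_rfl)
    (Submodule.factor h.le) hf (Submodule.factor_surjective h.le), Module.length_eq_one, add_comm]
  rw [LinearMap.exact_iff, Submodule.range_mapQ, Submodule.range_subtype, Submodule.factor,
    Submodule.ker_mapQ]
  rfl

lemma InfIrred.colon_singleton {R : Type*} [CommRing R] {J : Ideal R} (hJ : InfIrred J) {e : R}
    (he : e ∉ J) : InfIrred (J.colon {e}) := by
  refine ⟨fun h ↦ he ?_, fun A B hAB ↦ ?_⟩
  · have h1 : (1 : R) ∈ J.colon {e} := by rw [isMax_iff_eq_top.mp h]; trivial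
    simpa using h1
  have mem {x : R} : x ∈ J.colon {e} ↔ e * x ∈ J := by
    rw [Submodule.mem_colon_singleton, smul_eq_mul, mul_comm]
  have key : (J ⊔ Ideal.span {e} * A) ⊓ (J ⊔ Ideal.span {e} * B) = J := by
    refine le_antisymm (fun x ⟨hxA, hxB⟩ ↦ ?_) (le_inf le_sup_left le_sup_left)
    obtain ⟨j, hj, y, hy, rfl⟩ := Submodule.mem_sup.mp hxA
    obtain ⟨k, hk, z, hz, hyz⟩ := Submodule.mem_sup.mp hxB
    obtain ⟨a, ha, rfl⟩ := Ideal.mem_span_singleton_mul.mp hy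
    obtain ⟨b, hb, rfl⟩ := Ideal.mem_span_singleton_mul.mp hz
    have hab : a - b ∈ J.colon {e} := by
      rw [mem, show e * (a - b) = k - j by linear_combination -hyz]
      exact J.sub_mem hk hj
    have haB : a ∈ B := by
      have : a - b ∈ B := (hAB ▸ inf_le_right : J.colon {e} ≤ B) hab
      simpa using B.add_mem this hb
    exact J.add_mem hj (mem.mp (hAB ▸ ⟨ha, haB⟩))
  have of_sup_eq {C : Ideal R} (hC : J ⊔ Ideal.span {e} * C = J) : C ≤ J.colon {e} :=
    fun c hc ↦ mem.mpr <| sup_eq_left.mp hC <|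
      Ideal.mul_mem_mul (Ideal.mem_span_singleton_self e) hc
  rcases hJ.2 key with h | h
  · exact .inl (le_antisymm (of_sup_eq h) (hAB ▸ inf_le_left))
  · exact .inr (le_antisymm (of_sup_eq h) (hAB ▸ inf_le_right))

namespace IsLocalRing

variable {R : Type*} [CommRing R] [IsLocalRing R]

lemma maximalIdeal_mul_le_of_covBy {A B : Ideal R} (h : A ⋖ B) {b : R} (hb : b ∈ B) {t : R}
    (ht : t ∈ maximalIdeal R) : t * b ∈ A := by
  by_contra htb
  have hB : A ⊔ Ideal.span {t * b} = B := by
    refine (h.wcovBy.eq_or_eq le_sup_left (sup_le h.le ?_)).resolve_left fun hA ↦ htb ?_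
    · exact (Ideal.span_singleton_le_iff_mem _).mpr (B.mul_mem_left t hb)
    · rw [← hA]
      exact Ideal.mem_sup_right (Ideal.mem_span_singleton_self _)
  rw [← hB] at hb
  obtain ⟨a, ha, y, hy, hay⟩ := Submodule.mem_sup.mp hb
  obtain ⟨s, rfl⟩ := Ideal.mem_span_singleton'.mp hy
  have hu : IsUnit (1 - s * t) :=
    isUnit_one_sub_self_of_mem_nonunits _ ((maximalIdeal R).mul_mem_left s ht)
  have hbA : b ∈ A := by
    rw [← Ideal.unit_mul_mem_iff_mem A hu, show (1 - s * t) * b = a by linear_combination -hay]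
    exact ha
  exact htb (A.mul_mem_left t hbA)

/-- Any two nonzero elements of the socle of `R ⧸ J`, for `J` irreducible, are associated. -/
lemma exists_sub_mul_mem_of_infIrred {J : Ideal R} (hJ : InfIrred J) {x y : R} (hx : x ∉ J)
    (hy : y ∉ J) (hmy : ∀ t ∈ maximalIdeal R, t * y ∈ J) : ∃ u, y - u * x ∈ J := by
  by_contra! hne
  have sup_ne {z : R} (hz : z ∉ J) : J ⊔ Ideal.span {z} ≠ J := fun h ↦
    hz (h ▸ Ideal.mem_sup_right (Ideal.mem_span_singleton_self z))
  refine (hJ.2 (le_antisymm (fun w ⟨hwx, hwy⟩ ↦ ?_) (le_inf le_sup_left le_sup_left))).elim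
    (sup_ne hx) (sup_ne hy)
  obtain ⟨j, hj, v, hv, rfl⟩ := Submodule.mem_sup.mp hwx
  obtain ⟨k, hk, v', hv', hw⟩ := Submodule.mem_sup.mp hwy
  obtain ⟨a, rfl⟩ := Ideal.mem_span_singleton'.mp hv
  obtain ⟨b, rfl⟩ := Ideal.mem_span_singleton'.mp hv'
  by_cases hb : b ∈ maximalIdeal R
  · rw [← hw]
    exact J.add_mem hk (hmy b hb)
  · obtain ⟨c, hc⟩ := (notMem_maximalIdeal.mp hb).exists_left_inv
    refine absurd ?_ (hne (c * a))
    rw [show y - c * a * x = c * (j - k) by linear_combination (-y) * hc + c * hw]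
    exact J.mul_mem_left c (J.sub_mem hj hk)

lemma colon_wcovBy_colon_of_covBy {J A B : Ideal R} (hJ : InfIrred J) (h : A ⋖ B) :
    J.colon (B : Set R) ⩿ J.colon (A : Set R) := by
  refine ⟨Submodule.colon_mono le_rfl h.le, fun X hX hXA ↦ hXA.not_ge fun y hy ↦ ?_⟩
  obtain ⟨b, hbB, hbA⟩ := SetLike.exists_of_lt h.lt
  have hB : A ⊔ Ideal.span {b} = B := by
    refine (h.wcovBy.eq_or_eq le_sup_left (sup_le h.le ?_)).resolve_left fun hA ↦ hbA ?_
    · exact (Ideal.span_singleton_le_iff_mem _).mpr hbB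
    · rw [← hA]
      exact Ideal.mem_sup_right (Ideal.mem_span_singleton_self _)
  have mem_colon {z : R} (hzA : z ∈ J.colon (A : Set R)) (hzb : z * b ∈ J) :
      z ∈ J.colon (B : Set R) := by
    rw [Submodule.mem_colon]
    intro s hs
    rw [← hB] at hs
    obtain ⟨a, ha, v, hv, rfl⟩ := Submodule.mem_sup.mp hs
    obtain ⟨c, rfl⟩ := Ideal.mem_span_singleton'.mp hv
    rw [smul_eq_mul, show z * (a + c * b) = z * a + c * (z * b) by ring]
    exact J.add_mem (Submodule.mem_colon.mp hzA a ha) (J.mul_mem_left c hzb)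
  obtain ⟨x, hxX, hxB⟩ := SetLike.exists_of_lt hX
  have hxA := hXA.le hxX
  by_cases hyb : y * b ∈ J
  · exact hX.le (mem_colon hy hyb)
  obtain ⟨u, hu⟩ := exists_sub_mul_mem_of_infIrred hJ (fun hxb ↦ hxB (mem_colon hxA hxb)) hyb
    fun t ht ↦ by
      rw [mul_left_comm]
      exact Submodule.mem_colon.mp hy _ (maximalIdeal_mul_le_of_covBy h hbB ht)
  have hyx : y - u * x ∈ X := hX.le <| mem_colon
    (Ideal.sub_mem _ hy (Ideal.mul_mem_left _ u hxA)) (by convert hu using 1; ring)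
  simpa using X.add_mem hyx (X.mul_mem_left u hxX)

variable [IsNoetherianRing R]

lemma isFiniteLength_quotient_of_radical_eq_maximalIdeal {J : Ideal R}
    (hJ : J.radical = maximalIdeal R) : IsFiniteLength R (R ⧸ J) := by
  have : IsArtinianRing (R ⧸ J) := by
    refine quotient_artinian_of_mem_minimalPrimes_of_isLocalRing J ?_
    rw [← Ideal.radical_minimalPrimes, hJ, Ideal.minimalPrimes_eq_subsingleton_self]
    rfl
  exact isFiniteLength_iff_isNoetherian_isArtinian.mpr
    ⟨inferInstance, isArtinian_of_surjective_algebraMap (Ideal.Quotient.mk_surjective (I := J))⟩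

lemma length_colon_add_length_le {J A B : Ideal R} (hJ : InfIrred J)
    (hfin : Module.length R (R ⧸ J) ≠ ⊤) (hJA : J ≤ A) (hAB : A ≤ B) :
    Module.length R (R ⧸ J.colon (B : Set R)) + Module.length R (R ⧸ B) ≤
      Module.length R (R ⧸ J.colon (A : Set R)) + Module.length R (R ⧸ A) := by
  obtain ⟨n, hn⟩ : ∃ n : ℕ, Module.length R (R ⧸ A) ≤ Module.length R (R ⧸ B) + n := by
    obtain ⟨n, hn⟩ := ENat.ne_top_iff_exists.mp
      (ne_top_of_le_ne_top hfin (Submodule.length_quotient_anti hJA))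
    exact ⟨n, hn ▸ le_add_self⟩
  induction n generalizing B with
  | zero =>
    rcases hAB.eq_or_lt with rfl | hlt
    · rfl
    obtain ⟨C, hAC, hCB⟩ := exists_le_covBy_of_lt hlt
    have hB := ne_top_of_le_ne_top hfin (Submodule.length_quotient_anti (hJA.trans hAB))
    have h := (Submodule.length_quotient_anti hAC).trans hn
    rw [hCB.length_quotient_eq_add_one, Nat.cast_zero, add_zero] at h
    exact absurd h (not_le.mpr ((ENat.lt_add_one_iff hB).mpr le_rfl))
  | succ n ih =>
    rcases hAB.eq_or_lt with rfl | hlt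
    · rfl
    obtain ⟨C, hAC, hCB⟩ := exists_le_covBy_of_lt hlt
    have hC := hCB.length_quotient_eq_add_one
    refine le_trans ?_ (ih hAC (by rw [hC]; convert hn using 1; push_cast; ring))
    rw [hC, add_comm _ (1 : ℕ∞), ← add_assoc]
    gcongr
    rcases (colon_wcovBy_colon_of_covBy hJ hCB).covBy_or_eq with h | h
    · exact h.length_quotient_eq_add_one.le
    · rw [h]
      exact le_self_add

/-- In a Noetherian local ring, ideals containing an irreducible ideal primary to the maximal ideal
are closed under the double annihilator. -/
theorem colon_colon_eq_of_infIrred {J A : Ideal R} (hJ : InfIrred J)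
    (hrad : J.radical = maximalIdeal R) (hJA : J ≤ A) :
    J.colon (J.colon (A : Set R) : Set R) = A := by
  have hfin : Module.length R (R ⧸ J) ≠ ⊤ :=
    Module.length_ne_top_iff.mpr (isFiniteLength_quotient_of_radical_eq_maximalIdeal hrad)
  have hA : A ≤ J.colon (J.colon (A : Set R) : Set R) := fun a ha ↦
    Submodule.mem_colon.mpr fun s hs ↦ by
      rw [smul_eq_mul, mul_comm]
      exact Submodule.mem_colon.mp hs a ha
  have length_add {C : Ideal R} (hC : J ≤ C) :
      Module.length R (R ⧸ J.colon (C : Set R)) + Module.length R (R ⧸ C) =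
        Module.length R (R ⧸ J) := by
    refine le_antisymm ?_ ?_
    · have := length_colon_add_length_le hJ hfin le_rfl hC
      rwa [(Submodule.colon_eq_top_iff_subset (N := J) (J : Set R)).mpr le_rfl,
        Module.length_eq_zero (M := R ⧸ (⊤ : Ideal R)), zero_add] at this
    · have := length_colon_add_length_le hJ hfin hC le_top
      rwa [Submodule.top_coe, Submodule.colon_univ,
        Module.length_eq_zero (M := R ⧸ (⊤ : Ideal R)), add_zero] at this
  have hJc : J ≤ J.colon (A : Set R) := Ideal.le_colon
  have hlen : Module.length R (R ⧸ J.colon (J.colon (A : Set R) : Set R)) =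
      Module.length R (R ⧸ A) := by
    have h1 := length_add hJA
    rw [← length_add hJc, add_comm] at h1
    exact (ENat.add_left_injective_of_ne_top
      (ne_top_of_le_ne_top hfin (Submodule.length_quotient_anti hJc)) h1).symm
  by_contra hne
  obtain ⟨C, hAC, hC⟩ := exists_le_covBy_of_lt (hA.lt_of_ne' hne)
  have h := Submodule.length_quotient_anti hAC
  rw [hC.length_quotient_eq_add_one, hlen] at h
  exact absurd h (not_le.mpr ((ENat.lt_add_one_iff
    (ne_top_of_le_ne_top hfin (Submodule.length_quotient_anti hJA))).mpr le_rfl))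

end IsLocalRing


/-- An ideal of a local ring is a parameter ideal if it is generated by a system of
parameters: `dim R` elements generating an ideal whose radical is the maximal ideal. -/
def Ideal.IsParameterIdeal {R : Type*} [CommRing R] [IsLocalRing R] (J : Ideal R) : Prop :=
  ∃ s : Finset R, Ideal.span (s : Set R) = J ∧ (s.card : WithBot ℕ∞) = ringKrullDim R ∧
    J.radical = IsLocalRing.maximalIdeal R

/-- A Noetherian local ring is Gorenstein if it is Cohen–Macaulay and every parameter ideal
is irreducible. -/
def IsGorensteinLocalRing (R : Type*) [CommRing R] [IsLocalRing R] : Prop :=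
  IsCohenMacaulayLocalRing R ∧ ∀ J : Ideal R, J.IsParameterIdeal → InfIrred J

/-- Let `(R,m)` be a Gorenstein Noetherian local ring and let `I` be an
`m`-primary ideal. Let `J ⊆ I` be an ideal generated by a system of parameters and set
`E = (J :_R I)/J`, the canonical module of `R/I`. If `E` is generated as an `R`-module by
nonzero elements `e_1,…,e_r` (i.e. `J : I = J + (e_1,…,e_r)` with each `e_i ∉ J`), and
`I_i = ann_R(e_i) = (J : e_i)`, then each `I_i` is an irreducible ideal and
`I = ⋂_{i=1}^r I_i`. -/
theorem irreducible_decomposition_of_canonical_module_generators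
    {R : Type*} [CommRing R] [IsLocalRing R] [IsNoetherianRing R]
    (hGor : IsGorensteinLocalRing R)
    (I J : Ideal R) (hI : I.radical = IsLocalRing.maximalIdeal R)
    (hJI : J ≤ I) (hJ : J.IsParameterIdeal)
    (r : ℕ) (e : Fin r → R)
    (he : ∀ i, e i ∈ J.colon I) (he0 : ∀ i, e i ∉ J)
    (hgen : J.colon I = J ⊔ Ideal.span (Set.range e)) :
    (∀ i, InfIrred (J.colon (Ideal.span {e i}))) ∧
      I = ⨅ i, J.colon (Ideal.span {e i}) := by
  have hirr := hGor.2 J hJ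
  obtain ⟨-, -, -, hrad⟩ := hJ
  refine ⟨fun i ↦ ?_, ?_⟩
  · rw [Ideal.colon_span]
    exact hirr.colon_singleton (he0 i)
  · rw [← IsLocalRing.colon_colon_eq_of_infIrred hirr hrad hJI, hgen]
    simp_rw [Ideal.colon_span]
    rw [← Submodule.colon_iUnion, Set.iUnion_singleton_eq_range]
    refine le_antisymm (Submodule.colon_mono le_rfl fun x hx ↦
      Ideal.mem_sup_right (Ideal.subset_span hx)) fun x hx ↦ Submodule.mem_colon.mpr fun s hs ↦ ?_
    rw [← Ideal.colon_span] at hx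
    obtain ⟨j, hj, v, hv, rfl⟩ := Submodule.mem_sup.mp hs
    rw [smul_add]
    exact J.add_mem (J.mul_mem_left x hj) (Submodule.mem_colon.mp hx v hv)
end

section
/- Let k be an infinite field, R = k[s,t], and let I ⊂ R be a height-2 ideal minimally generated by three forms f_1, f_2, f_3 of degree 4 whose Hilbert–Burch matrix φ has both columns of degree 2, with first column (s^2, st, t^2)^t. In S = R[x,y,z], write f = s^2 x + st y + t^2 z and g = s^2 u + st v + t^2 w, where u, v, w are the k-linear forms in x, y, z determined by the second column of φ, and set h_1 = −syu − tzu + sxv + txw, h_2 = −szu − tzv + sxw + tyw, and F = −z^2u^2 + yzuv − xzv^2 − y^2uw + 2xzuw + xyvw − x^2w^2. If the ideal of 2×2 minors of the matrix with rows (x, y, z) and (u, v, w) has height 2 in k[x,y,z], then the defining ideal of the Rees algebra, i.e. the kernel of the S-algebra map S → R[It] sending x, y, z to f_1 t, f_2 t, f_3 t, equals (f, g, h_1, h_2, F). -/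
open MvPolynomial

/-- The height of an ideal: the infimum of the heights of the prime ideals containing it. -/
noncomputable def Ideal.heightOf {R : Type*} [CommRing R] (I : Ideal R) : ℕ∞ :=
  ⨅ (P : PrimeSpectrum R) (_ : I ≤ P.asIdeal), Order.height P

/-- The `k`-algebra map `k[s,t,x,y,z] → k[s,t][T]` sending `s ↦ s`, `t ↦ t` and the variables
`x, y, z` to `f₁T, f₂T, f₃T`.  Its kernel is the defining ideal of the Rees algebra
`R[It]`, `I = (f₁,f₂,f₃)`, presented over `S = R[x,y,z] ≅ k[s,t,x,y,z]`. -/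
noncomputable def reesPresentation (k : Type*) [CommRing k]
    (f : Fin 3 → MvPolynomial (Fin 2) k) :
    MvPolynomial (Fin 5) k →ₐ[k] Polynomial (MvPolynomial (Fin 2) k) :=
  MvPolynomial.aeval
    ![Polynomial.C (X 0), Polynomial.C (X 1),
      Polynomial.C (f 0) * Polynomial.X, Polynomial.C (f 1) * Polynomial.X,
      Polynomial.C (f 2) * Polynomial.X]

/-- The embedding `k[x,y,z] → k[s,t,x,y,z]`, `x ↦ x, y ↦ y, z ↦ z`. -/
noncomputable def toFive (k : Type*) [CommRing k] :
    MvPolynomial (Fin 3) k →ₐ[k] MvPolynomial (Fin 5) k :=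
  MvPolynomial.rename (Fin.natAdd 2)

theorem Ideal.two_le_height_of_heightOf_eq_two {R : Type*} [CommRing R] {I P : Ideal R}
    (hI : I.heightOf = 2) [hP : P.IsPrime] (hIP : I ≤ P) : 2 ≤ P.height := by
  have h : I.heightOf ≤ Order.height (⟨P, hP⟩ : PrimeSpectrum R) := iInf₂_le (⟨P, hP⟩ : PrimeSpectrum R) hIP
  rwa [hI, ← PrimeSpectrum.height_eq_orderHeight] at h

theorem Ideal.isUnit_of_dvd_of_heightOf_eq_two {R : Type*} [CommRing R] [IsNoetherianRing R]
    {a b c d : R} (h : (Ideal.span {a, b, c}).heightOf = 2) (ha : d ∣ a) (hb : d ∣ b)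
    (hc : d ∣ c) : IsUnit d := by
  by_contra hd
  obtain ⟨p, hp⟩ := (Ideal.span {d}).nonempty_minimalPrimes (by simpa using hd)
  have := hp.1.1
  have hle : Ideal.span {a, b, c} ≤ p := by
    refine le_trans (Ideal.span_le.2 ?_) hp.1.2
    rintro x (rfl | rfl | rfl) <;> simpa [Ideal.mem_span_singleton]
  have h1 := Ideal.height_le_one_of_isPrincipal_of_mem_minimalPrimes (Ideal.span {d}) p hp
  have h2 := (Ideal.two_le_height_of_heightOf_eq_two h hle).trans h1
  exact absurd h2 (by decide)

theorem dvd_of_dvd_mul_of_isUnit_common_divisors {R : Type*} [CommRing R] [IsDomain R]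
    [UniqueFactorizationMonoid R] {a b c m p : R}
    (h : ∀ d, d ∣ a → d ∣ b → d ∣ c → IsUnit d)
    (ha : m ∣ p * a) (hb : m ∣ p * b) (hc : m ∣ p * c) : m ∣ p := by
  classical
  obtain ⟨_⟩ : Nonempty (GCDMonoid R) := ⟨UniqueFactorizationMonoid.toGCDMonoid R⟩
  have hu : IsUnit (gcd a (gcd b c)) := h _ (gcd_dvd_left _ _)
    ((gcd_dvd_right _ _).trans (gcd_dvd_left _ _)) ((gcd_dvd_right _ _).trans (gcd_dvd_right _ _))
  have h1 : m ∣ p * gcd b c := (dvd_gcd hb hc).trans (gcd_mul_left' p b c).dvd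
  have h2 : m ∣ p * gcd a (gcd b c) := (dvd_gcd ha h1).trans (gcd_mul_left' p a _).dvd
  exact (hu.dvd_mul_right).1 h2

/-- Wiebe's lemma for the ideal `(s, t)`: the colon ideal `(f, g) : (s, t)` is generated by
`f`, `g` and their Sylvester form. -/
theorem Ideal.mem_span_sylvester_of_mul_mem {S : Type*} [CommRing S] [IsDomain S]
    {s t f g f₁ f₂ g₁ g₂ p : S} (hs : Prime s) (hst : ¬ s ∣ t) (hf : Prime f) (hfg : ¬ f ∣ g)
    (hf' : f = s * f₁ + t * f₂) (hg' : g = s * g₁ + t * g₂)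
    (hsp : s * p ∈ Ideal.span {f, g}) (htp : t * p ∈ Ideal.span {f, g}) :
    p ∈ Ideal.span {f, g, f₁ * g₂ - f₂ * g₁} := by
  obtain ⟨α, β, h₁⟩ := Ideal.mem_span_pair.1 hsp
  obtain ⟨γ, δ, h₂⟩ := Ideal.mem_span_pair.1 htp
  have h₃ : (t * α - s * γ) * f + (t * β - s * δ) * g = 0 := by
    linear_combination t * h₁ - s * h₂
  obtain ⟨ε, hε⟩ : f ∣ t * β - s * δ :=
    (hf.dvd_or_dvd (⟨-(t * α - s * γ), by linear_combination h₃⟩ :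
      f ∣ (t * β - s * δ) * g)).resolve_right hfg
  have hε' : t * α - s * γ = -ε * g := by
    apply mul_right_cancel₀ hf.ne_zero
    linear_combination h₃ - g * hε
  obtain ⟨κ, hκ⟩ : s ∣ α + ε * g₂ :=
    (hs.dvd_or_dvd (⟨γ - ε * g₁, by linear_combination hε' - ε * hg'⟩ :
      s ∣ t * (α + ε * g₂))).resolve_left hst
  obtain ⟨μ, hμ⟩ : s ∣ β - ε * f₂ :=
    (hs.dvd_or_dvd (⟨δ + ε * f₁, by linear_combination hε + ε * hf'⟩ :
      s ∣ t * (β - ε * f₂))).resolve_left hst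
  have hp : p = κ * f + μ * g - ε * (f₁ * g₂ - f₂ * g₁) := by
    apply mul_left_cancel₀ hs.ne_zero
    linear_combination -h₁ + f * hκ + g * hμ - ε * g₂ * hf' + ε * f₂ * hg'
  rw [hp]
  refine sub_mem (add_mem ?_ ?_) ?_ <;> exact Ideal.mul_mem_left _ _ (Ideal.subset_span (by simp))

attribute [local instance] MvPolynomial.gradedAlgebra in
theorem MvPolynomial.X_mem_radical_span_of_heightOf_eq_two {k : Type*} [Field k] {ι : Type*}
    {f : ι → MvPolynomial (Fin 2) k} {n : ι → ℕ} (hf : ∀ j, (f j).IsHomogeneous (n j))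
    (hht : (Ideal.span (Set.range f)).heightOf = 2) (i : Fin 2) :
    X i ∈ (Ideal.span (Set.range f)).radical := by
  set 𝒜 := homogeneousSubmodule (Fin 2) k
  have hI : (Ideal.span (Set.range f)).IsHomogeneous 𝒜 := by
    refine Ideal.homogeneous_span _ _ ?_
    rintro _ ⟨j, rfl⟩
    exact ⟨n j, hf j⟩
  set I := Ideal.span (Set.range f)
  let M : Ideal (MvPolynomial (Fin 2) k) := RingHom.ker (constantCoeff (σ := Fin 2) (R := k))
  have hM : M.IsPrime := RingHom.ker_isPrime _
  rw [Ideal.radical_eq_sInf, Ideal.mem_sInf]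
  rintro P ⟨hIP, hP⟩
  have hPc : (P.homogeneousCore 𝒜).toIdeal.IsPrime := hP.homogeneousCore
  have hIPc : I ≤ (P.homogeneousCore 𝒜).toIdeal :=
    hI.toIdeal_homogeneousCore_eq_self.symm.le.trans (Ideal.homogeneousCore_mono 𝒜 hIP)
  have hle : (P.homogeneousCore 𝒜).toIdeal ≤ M := by
    intro x hx
    have h0 : homogeneousComponent 0 x ∈ (P.homogeneousCore 𝒜).toIdeal :=
      homogeneousComponent_mem_of_mem (P.homogeneousCore 𝒜).isHomogeneous hx 0
    rw [homogeneousComponent_zero] at h0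
    by_contra hx0
    exact hPc.ne_top (Ideal.eq_top_of_isUnit_mem _ h0
      ((isUnit_iff_ne_zero.2 fun h => hx0 (by simpa [M, constantCoeff_eq] using h)).map C))
  have heq : (P.homogeneousCore 𝒜).toIdeal = M := by
    by_contra hne
    have h2 := Ideal.two_le_height_of_heightOf_eq_two hht hIPc
    have h3 := Ideal.height_add_one_le_of_lt_of_isPrime (lt_of_le_of_ne hle hne)
    have h4 := Ideal.height_le_ringKrullDim_of_ne_top hM.ne_top
    rw [MvPolynomial.ringKrullDim_of_isNoetherianRing, ringKrullDim_eq_zero_of_field] at h4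
    have h5 : M.height ≤ 2 := by
      rw [← WithBot.coe_le_coe]
      simpa using h4
    have h6 := (add_le_add_left h2 1).trans (h3.trans h5)
    exact absurd h6 (by decide)
  apply Ideal.toIdeal_homogeneousCore_le 𝒜 P
  rw [heq]
  simp [M]

theorem toFive_X (k : Type*) [CommRing k] (i : Fin 3) :
    toFive k (X i) = X (Fin.natAdd 2 i) := by
  simp [toFive]

theorem exists_eq_toFive_add (k : Type*) [CommRing k] (p : MvPolynomial (Fin 5) k) :
    ∃ q A B, p = toFive k q + X 0 * A + X 1 * B := by
  induction p using MvPolynomial.induction_on with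
  | C a => exact ⟨C a, 0, 0, by simp [toFive]⟩
  | add p q hp hq =>
    obtain ⟨p, A, B, rfl⟩ := hp
    obtain ⟨q, A', B', rfl⟩ := hq
    exact ⟨p + q, A + A', B + B', by rw [map_add]; ring⟩
  | mul_X p i hp =>
    obtain ⟨p, A, B, rfl⟩ := hp
    refine Fin.addCases (m := 2) (n := 3) (fun j => ?_) (fun j => ?_) i
    · fin_cases j
      · exact ⟨0, toFive k p + X 0 * A + X 1 * B, 0, by simp; ring⟩
      · exact ⟨0, 0, toFive k p + X 0 * A + X 1 * B, by simp; ring⟩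
    · exact ⟨p * X j, A * X (Fin.natAdd 2 j), B * X (Fin.natAdd 2 j), by
        rw [map_mul, toFive_X]; ring⟩

theorem eq_zero_of_toFive_eq (k : Type*) [CommRing k] {q : MvPolynomial (Fin 3) k}
    {A B : MvPolynomial (Fin 5) k} (h : toFive k q = X 0 * A + X 1 * B) : q = 0 := by
  let π : MvPolynomial (Fin 5) k →ₐ[k] MvPolynomial (Fin 3) k := aeval ![0, 0, X 0, X 1, X 2]
  have hπ : π.comp (toFive k) = AlgHom.id k _ := by
    ext i
    fin_cases i <;> simp [π, toFive_X]
  have := congrArg π h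
  rw [← AlgHom.comp_apply, hπ] at this
  simpa [π] using this

theorem eq_zero_of_linear_eq_quadratic (k : Type*) [CommRing k] {q₀ q₁ : MvPolynomial (Fin 3) k}
    {A B D : MvPolynomial (Fin 5) k}
    (h : X 0 * toFive k q₀ + X 1 * toFive k q₁ = X 0 ^ 2 * A + X 0 * X 1 * B + X 1 ^ 2 * D) :
    q₀ = 0 ∧ q₁ = 0 := by
  let ψ (a b : k) : MvPolynomial (Fin 5) k →ₐ[k] DualNumber (MvPolynomial (Fin 3) k) :=
    aeval ![TrivSqZeroExt.inr (C a), TrivSqZeroExt.inr (C b), TrivSqZeroExt.inl (X 0),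
      TrivSqZeroExt.inl (X 1), TrivSqZeroExt.inl (X 2)]
  have hψ (a b : k) : (ψ a b).comp (toFive k) = TrivSqZeroExt.inlAlgHom k _ _ := by
    ext i : 1
    fin_cases i <;> simp [ψ, toFive_X]
  have hψ' (a b : k) (q) : ψ a b (toFive k q) = TrivSqZeroExt.inl q :=
    DFunLike.congr_fun (hψ a b) q
  have key (a b : k) : C a * q₀ + C b * q₁ = 0 := by
    have := congrArg (fun z => TrivSqZeroExt.snd (ψ a b z)) h
    simp only [map_add, map_mul, hψ', map_pow] at this
    simpa [ψ, pow_two] using this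
  exact ⟨by simpa using key 1 0, by simpa using key 0 1⟩

theorem prime_sq_mul_add (k : Type*) [Field k] :
    Prime (X 0 ^ 2 * X 2 + X 0 * X 1 * X 3 + X 1 ^ 2 * X 4 : MvPolynomial (Fin 5) k) := by
  rw [← irreducible_iff_prime, add_assoc]
  have hs : Prime (X 0 : MvPolynomial (Fin 5) k) := X_prime
  have hrel : IsRelPrime (X 0 ^ 2 : MvPolynomial (Fin 5) k)
      (X 0 * X 1 * X 3 + X 1 ^ 2 * X 4) := by
    apply IsRelPrime.pow_left
    rw [hs.irreducible.isRelPrime_iff_not_dvd]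
    intro hd
    have hd : (X 0 : MvPolynomial (Fin 5) k) ∣ X 1 ^ 2 * X 4 :=
      (dvd_add_right (dvd_mul_of_dvd_left (dvd_mul_right _ _) _)).1 hd
    rcases hs.dvd_or_dvd hd with h | h
    · simpa using X_dvd_X.1 (hs.dvd_of_dvd_pow h)
    · simpa using X_dvd_X.1 h
  refine irreducible_mul_X_add _ _ _ (pow_ne_zero _ hs.ne_zero) ?_ ?_ hrel
  · intro h
    have := vars_pow _ _ h
    simp [vars_X] at this
  · classical
    intro h
    rcases Finset.mem_union.1 (vars_add_subset _ _ h) with h | h <;>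
      rcases Finset.mem_union.1 (vars_mul _ _ h) with h | h
    · rcases Finset.mem_union.1 (vars_mul _ _ h) with h | h <;> simp [vars_X] at h
    · simp [vars_X] at h
    · have := vars_pow _ _ h
      simp [vars_X] at this
    · simp [vars_X] at h

theorem exists_pow_mul_mem_of_mem_ker_reesPresentation {k : Type*} [Field k]
    {Q : Ideal (MvPolynomial (Fin 5) k)} {f : Fin 3 → MvPolynomial (Fin 2) k}
    (hQ : ∀ i j, rename (Fin.castAdd 3) (f i) * X (Fin.natAdd 2 j) -
      rename (Fin.castAdd 3) (f j) * X (Fin.natAdd 2 i) ∈ Q)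
    {p : MvPolynomial (Fin 5) k} (hp : p ∈ RingHom.ker (reesPresentation k f)) (i : Fin 3) :
    ∃ n : ℕ, rename (Fin.castAdd 3) (f i) ^ n * p ∈ Q := by
  let c : MvPolynomial (Fin 5) k ⧸ Q := Ideal.Quotient.mk Q (rename (Fin.castAdd 3) (f i))
  let L := Localization.Away c
  let ρ : MvPolynomial (Fin 5) k →+* L :=
    (algebraMap (MvPolynomial (Fin 5) k ⧸ Q) L).comp (Ideal.Quotient.mk Q)
  let σ : MvPolynomial (Fin 2) k →+* L :=
    ρ.comp (rename (R := k) (Fin.castAdd (n := 2) 3)).toRingHom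
  have hσ : σ (f i) * IsLocalization.Away.invSelf c = 1 :=
    IsLocalization.Away.mul_invSelf (S := L) c
  let τ : L := ρ (X (Fin.natAdd 2 i)) * IsLocalization.Away.invSelf c
  have hX (j : Fin 3) : ρ (X (Fin.natAdd 2 j)) = σ (f j) * τ := by
    have h1 : σ (f i) * ρ (X (Fin.natAdd 2 j)) = σ (f j) * ρ (X (Fin.natAdd 2 i)) := by
      have := congrArg (algebraMap _ L) (Ideal.Quotient.eq_zero_iff_mem.2 (hQ i j))
      rw [map_zero, map_sub, map_sub, sub_eq_zero, map_mul, map_mul, map_mul, map_mul] at this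
      exact this
    calc ρ (X (Fin.natAdd 2 j))
        = (σ (f i) * IsLocalization.Away.invSelf c) * ρ (X (Fin.natAdd 2 j)) := by
          rw [hσ, one_mul]
      _ = (σ (f i) * ρ (X (Fin.natAdd 2 j))) * IsLocalization.Away.invSelf c := by ring
      _ = σ (f j) * τ := by rw [h1, mul_assoc]
  have hfac : (Polynomial.eval₂RingHom σ τ).comp (reesPresentation k f).toRingHom = ρ := by
    refine MvPolynomial.ringHom_ext (fun r => ?_) (fun j => ?_)
    · simp [reesPresentation, σ, Polynomial.algebraMap_apply, MvPolynomial.algebraMap_eq]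
    · refine Fin.addCases (m := 2) (n := 3) (fun j => ?_) (fun j => ?_) j
      · fin_cases j <;> simp [reesPresentation, σ]
      · rw [hX]
        fin_cases j <;> simp [reesPresentation]
  have h0 : ρ p = 0 := by
    rw [← hfac]
    simp only [RingHom.comp_apply]
    have : (reesPresentation k f).toRingHom p = 0 := hp
    rw [this, map_zero]
  obtain ⟨⟨_, n, rfl⟩, hn⟩ := (IsLocalization.map_eq_zero_iff (Submonoid.powers c) L _).1 h0
  refine ⟨n, ?_⟩
  rw [← Ideal.Quotient.eq_zero_iff_mem, map_mul, map_pow]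
  exact hn

theorem not_sq_mul_add_dvd_X (k : Type*) [Field k] (i : Fin 2) :
    ¬ (X 0 ^ 2 * X 2 + X 0 * X 1 * X 3 + X 1 ^ 2 * X 4 : MvPolynomial (Fin 5) k) ∣
      X (Fin.castAdd 3 i) := by
  rintro ⟨q, hq⟩
  fin_cases i
  · have hq : (X 0 : MvPolynomial (Fin 5) k) =
      (X 0 ^ 2 * X 2 + X 0 * X 1 * X 3 + X 1 ^ 2 * X 4) * q := hq
    have := (eq_zero_of_linear_eq_quadratic k (q₀ := 1) (q₁ := 0) (A := X 2 * q) (B := X 3 * q)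
      (D := X 4 * q) (by rw [map_one, map_zero]; linear_combination hq)).1
    exact one_ne_zero this
  · have hq : (X 1 : MvPolynomial (Fin 5) k) =
      (X 0 ^ 2 * X 2 + X 0 * X 1 * X 3 + X 1 ^ 2 * X 4) * q := hq
    have := (eq_zero_of_linear_eq_quadratic k (q₀ := 0) (q₁ := 1) (A := X 2 * q) (B := X 3 * q)
      (D := X 4 * q) (by rw [map_one, map_zero]; linear_combination hq)).2
    exact one_ne_zero this

theorem exists_eq_linear_combination_of_mem_span {k : Type*} [Field k]
    {u v w a b c : MvPolynomial (Fin 3) k} {f g h₁ h₂ r A₀ B₀ : MvPolynomial (Fin 5) k}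
    (hh₁ : h₁ = X 0 * toFive k a + X 1 * toFive k b)
    (hh₂ : h₂ = X 0 * toFive k b + X 1 * toFive k c)
    (hf : f = X 0 ^ 2 * X 2 + X 0 * X 1 * X 3 + X 1 ^ 2 * X 4)
    (hg : g = X 0 ^ 2 * toFive k u + X 0 * X 1 * toFive k v + X 1 ^ 2 * toFive k w)
    (hth₁ : X 1 * h₁ = X 2 * g - toFive k u * f)
    (hsh₂ : X 0 * h₂ = toFive k w * f - X 4 * g)
    (hsth : X 0 * h₁ - X 1 * h₂ = toFive k v * f - X 3 * g)
    (hr : r = X 0 * A₀ + X 1 * B₀)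
    (hrK : r ∈ Ideal.span {f, g, h₁, h₂, toFive k (a * c - b ^ 2)}) :
    ∃ l m A B ε, r = A * f + B * g + toFive k l * h₁ + toFive k m * h₂ + ε * (X 0 * h₁) := by
  simp only [Ideal.mem_span_insert, Ideal.mem_span_singleton'] at hrK
  obtain ⟨A, _, ⟨B, _, ⟨l, _, ⟨m, _, ⟨n, rfl⟩, rfl⟩, rfl⟩, rfl⟩, hr'⟩ := hrK
  obtain ⟨n₀, n₁, n₂, hn⟩ := exists_eq_toFive_add k n
  have hF : toFive k (a * c - b ^ 2) = toFive k a * toFive k c - toFive k b ^ 2 := by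
    simp only [map_sub, map_mul, map_pow]
  have h0 : n₀ * (a * c - b ^ 2) = 0 := by
    refine eq_zero_of_toFive_eq k
      (A := A₀ - A * (X 0 * X 2 + X 1 * X 3) - B * (X 0 * toFive k u + X 1 * toFive k v)
        - l * toFive k a - m * toFive k b - n₁ * toFive k (a * c - b ^ 2))
      (B := B₀ - A * (X 1 * X 4) - B * (X 1 * toFive k w)
        - l * toFive k b - m * toFive k c - n₂ * toFive k (a * c - b ^ 2)) ?_
    rw [map_mul]
    linear_combination hr - hr' - A * hf - B * hg - l * hh₁ - m * hh₂
      - toFive k (a * c - b ^ 2) * hn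
  have h0' : toFive k n₀ * toFive k (a * c - b ^ 2) = 0 := by rw [← map_mul, h0, map_zero]
  obtain ⟨l₀, l₁, l₂, hl⟩ := exists_eq_toFive_add k (l + n₁ * toFive k c - n₂ * toFive k b)
  obtain ⟨m₀, m₁, m₂, hm⟩ := exists_eq_toFive_add k (m - n₁ * toFive k b + n₂ * toFive k a)
  have hsF : X 0 * toFive k (a * c - b ^ 2) = toFive k c * h₁ - toFive k b * h₂ := by
    rw [hF, hh₁, hh₂]; ring
  have htF : X 1 * toFive k (a * c - b ^ 2) = toFive k a * h₂ - toFive k b * h₁ := by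
    rw [hF, hh₁, hh₂]; ring
  refine ⟨l₀, m₀, A - l₂ * toFive k u + m₁ * toFive k w - m₂ * toFive k v,
    B + l₂ * X 2 - m₁ * X 4 + m₂ * X 3, l₁ + m₂, ?_⟩
  linear_combination hr' + toFive k (a * c - b ^ 2) * hn + h0' + n₁ * hsF + n₂ * htF
    + h₁ * hl + h₂ * hm + l₂ * hth₁ + m₁ * hsh₂ - m₂ * hsth

theorem mem_span_of_X_mul_mem {k : Type*} [Field k]
    {u v w a b c : MvPolynomial (Fin 3) k} {f g h₁ h₂ p : MvPolynomial (Fin 5) k}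
    (ha : a = X 0 * v - X 1 * u) (hb : b = X 0 * w - X 2 * u) (hc : c = X 1 * w - X 2 * v)
    (hgcd : ∀ d, d ∣ a → d ∣ b → d ∣ c → IsUnit d)
    (hh₁ : h₁ = X 0 * toFive k a + X 1 * toFive k b)
    (hh₂ : h₂ = X 0 * toFive k b + X 1 * toFive k c)
    (hf : f = X 0 ^ 2 * X 2 + X 0 * X 1 * X 3 + X 1 ^ 2 * X 4)
    (hg : g = X 0 ^ 2 * toFive k u + X 0 * X 1 * toFive k v + X 1 ^ 2 * toFive k w)
    (hsp : X 0 * p ∈ Ideal.span {f, g, h₁, h₂, toFive k (a * c - b ^ 2)})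
    (htp : X 1 * p ∈ Ideal.span {f, g, h₁, h₂, toFive k (a * c - b ^ 2)}) :
    p ∈ Ideal.span {f, g, h₁, h₂, toFive k (a * c - b ^ 2)} := by
  have hx : toFive k (X 0) = X 2 := toFive_X k 0
  have hy : toFive k (X 1) = X 3 := toFive_X k 1
  have hz : toFive k (X 2) = X 4 := toFive_X k 2
  have hιa : toFive k a = X 2 * toFive k v - X 3 * toFive k u := by
    rw [ha, map_sub, map_mul, map_mul, hx, hy]
  have hιb : toFive k b = X 2 * toFive k w - X 4 * toFive k u := by
    rw [hb, map_sub, map_mul, map_mul, hx, hz]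
  have hιc : toFive k c = X 3 * toFive k w - X 4 * toFive k v := by
    rw [hc, map_sub, map_mul, map_mul, hy, hz]
  have hth₁ : X 1 * h₁ = X 2 * g - toFive k u * f := by
    rw [hh₁, hf, hg, hιa, hιb]; ring
  have hsh₂ : X 0 * h₂ = toFive k w * f - X 4 * g := by
    rw [hh₂, hf, hg, hιb, hιc]; ring
  have hsth : X 0 * h₁ - X 1 * h₂ = toFive k v * f - X 3 * g := by
    rw [hh₁, hh₂, hf, hg, hιa, hιc]; ring
  have hfp : Prime f := hf ▸ prime_sq_mul_add k
  have hfs : ¬ f ∣ X 0 := hf ▸ not_sq_mul_add_dvd_X k 0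
  have hft : ¬ f ∣ X 1 := hf ▸ not_sq_mul_add_dvd_X k 1
  have hfg : ¬ f ∣ g := by
    intro hd
    obtain ⟨q₁, hq₁⟩ : f ∣ h₁ := (hfp.dvd_or_dvd (hth₁ ▸
      dvd_sub (dvd_mul_of_dvd_right hd _) (dvd_mul_left _ _) : f ∣ X 1 * h₁)).resolve_left hft
    obtain ⟨q₂, hq₂⟩ : f ∣ h₂ := (hfp.dvd_or_dvd (hsh₂ ▸
      dvd_sub (dvd_mul_left _ _) (dvd_mul_of_dvd_right hd _) : f ∣ X 0 * h₂)).resolve_left hfs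
    have hab := eq_zero_of_linear_eq_quadratic k (q₀ := a) (q₁ := b) (A := X 2 * q₁)
      (B := X 3 * q₁) (D := X 4 * q₁) (by linear_combination hq₁ - hh₁ + q₁ * hf)
    have hbc := eq_zero_of_linear_eq_quadratic k (q₀ := b) (q₁ := c) (A := X 2 * q₂)
      (B := X 3 * q₂) (D := X 4 * q₂) (by linear_combination hq₂ - hh₂ + q₂ * hf)
    exact not_isUnit_zero (hgcd 0 (by rw [hab.1]) (by rw [hab.2]) (by rw [hbc.2]))
  obtain ⟨l, m, A, B, ε, hs⟩ := exists_eq_linear_combination_of_mem_span hh₁ hh₂ hf hg hth₁ hsh₂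
    hsth (A₀ := p) (B₀ := 0) (by ring) hsp
  obtain ⟨l', m', A', B', ε', ht⟩ := exists_eq_linear_combination_of_mem_span hh₁ hh₂ hf hg hth₁
    hsh₂ hsth (A₀ := 0) (B₀ := p) (by ring) htp
  obtain ⟨q, D, E, hq⟩ := exists_eq_toFive_add k (p - ε * h₁ - ε' * h₂)
  obtain ⟨e₁, e₂⟩ := eq_zero_of_linear_eq_quadratic k
    (q₀ := q - (l * a + m * b)) (q₁ := -(l * b + m * c))
    (A := A * X 2 + B * toFive k u - ε' * (toFive k w * X 2 - X 4 * toFive k u) - D)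
    (B := A * X 3 + B * toFive k v - ε' * (toFive k w * X 3 - X 4 * toFive k v) - E)
    (D := A * X 4 + B * toFive k w - ε' * (toFive k w * X 4 - X 4 * toFive k w)) (by
      simp only [map_sub, map_add, map_mul, map_neg]
      linear_combination hs - X 0 * hq + (A - ε' * toFive k w) * hf
        + (B + ε' * X 4) * hg + toFive k l * hh₁ + toFive k m * hh₂ - ε' * hsh₂)
  obtain ⟨e₃, e₄⟩ := eq_zero_of_linear_eq_quadratic k
    (q₀ := -(l' * a + m' * b)) (q₁ := q - (l' * b + m' * c))
    (A := (A' + ε' * toFive k v + ε * toFive k u) * X 2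
      + (B' - ε' * X 3 - ε * X 2) * toFive k u)
    (B := (A' + ε' * toFive k v + ε * toFive k u) * X 3
      + (B' - ε' * X 3 - ε * X 2) * toFive k v - D)
    (D := (A' + ε' * toFive k v + ε * toFive k u) * X 4
      + (B' - ε' * X 3 - ε * X 2) * toFive k w - E) (by
      simp only [map_sub, map_add, map_mul, map_neg]
      linear_combination ht - X 1 * hq + (A' + ε' * toFive k v + ε * toFive k u) * hf
        + (B' - ε' * X 3 - ε * X 2) * hg + toFive k l' * hh₁ + toFive k m' * hh₂
        + ε' * hsth - ε * hth₁)
  obtain ⟨r, hr⟩ : a * c - b ^ 2 ∣ q :=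
    dvd_of_dvd_mul_of_isUnit_common_divisors hgcd
      ⟨m', by linear_combination a * e₄ - b * e₃⟩
      ⟨-m, by linear_combination b * e₁ - a * e₂⟩
      ⟨l, by linear_combination c * e₁ - b * e₂⟩
  have hsq : X 0 * toFive k q = toFive k l * h₁ + toFive k m * h₂ := by
    have e₁ := congrArg (toFive k) e₁
    have e₂ := congrArg (toFive k) e₂
    simp only [map_sub, map_add, map_mul, map_neg, map_zero] at e₁ e₂
    linear_combination X 0 * e₁ + X 1 * e₂ - toFive k l * hh₁ - toFive k m * hh₂
  have htq : X 1 * toFive k q = toFive k l' * h₁ + toFive k m' * h₂ := by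
    have e₃ := congrArg (toFive k) e₃
    have e₄ := congrArg (toFive k) e₄
    simp only [map_sub, map_add, map_mul, map_neg, map_zero] at e₃ e₄
    linear_combination X 0 * e₃ + X 1 * e₄ - toFive k l' * hh₁ - toFive k m' * hh₂
  have hst : ¬ (X 0 : MvPolynomial (Fin 5) k) ∣ X 1 := by
    intro h
    simpa using X_dvd_X.1 h
  have hmem := Ideal.mem_span_sylvester_of_mul_mem (p := p - ε * h₁ - ε' * h₂ - toFive k q)
    (f₁ := X 0 * X 2 + X 1 * X 3) (f₂ := X 1 * X 4)
    (g₁ := X 0 * toFive k u + X 1 * toFive k v) (g₂ := X 1 * toFive k w)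
    X_prime hst hfp hfg (by rw [hf]; ring) (by rw [hg]; ring)
    (Ideal.mem_span_pair.2 ⟨A - ε' * toFive k w, B + ε' * X 4, by
      linear_combination -hs + ε' * hsh₂ + hsq⟩)
    (Ideal.mem_span_pair.2 ⟨A' + ε' * toFive k v + ε * toFive k u, B' - ε' * X 3 - ε * X 2, by
      linear_combination -ht - ε' * hsth + ε * hth₁ + htq⟩)
  simp only [Ideal.mem_span_insert, Ideal.mem_span_singleton'] at hmem ⊢
  obtain ⟨α, _, ⟨β, _, ⟨γ, rfl⟩, rfl⟩, h⟩ := hmem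
  refine ⟨α, _, ⟨β, _, ⟨ε, _, ⟨ε' + γ * X 1, _, ⟨toFive k r, rfl⟩, rfl⟩, rfl⟩, rfl⟩, ?_⟩
  have hr' := congrArg (toFive k) hr
  rw [map_mul] at hr'
  linear_combination h + hr' - γ * X 1 * (hh₂ + X 0 * hιb + X 1 * hιc)

theorem eq_sum_coeff_mul_X {k : Type*} [CommRing k] {u : MvPolynomial (Fin 3) k}
    (hu : u ∈ Submodule.span k (Set.range (X : Fin 3 → MvPolynomial (Fin 3) k))) :
    u = ∑ i, C (coeff (Finsupp.single i 1) u) * X i := by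
  induction hu using Submodule.span_induction with
  | mem x hx =>
    obtain ⟨j, rfl⟩ := hx
    simp [MvPolynomial.coeff_X, Finsupp.single_left_inj]
  | zero => simp
  | add x y _ _ hx hy =>
    conv_lhs => rw [hx, hy]
    simp [add_mul, Finset.sum_add_distrib]
  | smul a x _ hx =>
    conv_lhs => rw [hx]
    simp [Finset.smul_sum, smul_eq_C_mul, mul_assoc]

/-- balanced degree-4 case. Let `k` be an infinite field, `R = k[s,t]`,
and `I ⊂ R` a height-2 ideal minimally generated by three forms `f₁, f₂, f₃` of degree 4
whose Hilbert–Burch matrix `φ` has both columns of degree 2, the first column being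
`(s², st, t²)ᵗ`.  In `S = R[x,y,z]`, write `f = s²x + sty + t²z`, `g = s²u + stv + t²w`
with `u, v, w` the `k`-linear forms in `x,y,z` determined by the second column of `φ`, and
let `h₁ = −syu − tzu + sxv + txw`, `h₂ = −szu − tzv + sxw + tyw`,
`F = −z²u² + yzuv − xzv² − y²uw + 2xzuw + xyvw − x²w²`.  If the ideal of 2×2 minors of
`[[x,y,z],[u,v,w]]` has height 2 in `k[x,y,z]`, then the defining ideal of the Rees
algebra, i.e. the kernel of `S → R[It]`, `x,y,z ↦ f₁t, f₂t, f₃t`, equals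
`(f, g, h₁, h₂, F)`. -/
theorem rees_defining_ideal_deg4_balanced
    (k : Type*) [Field k] [Infinite k]
    (u v w : MvPolynomial (Fin 3) k)
    (hu : u ∈ Submodule.span k (Set.range (X : Fin 3 → MvPolynomial (Fin 3) k)))
    (hv : v ∈ Submodule.span k (Set.range (X : Fin 3 → MvPolynomial (Fin 3) k)))
    (hw : w ∈ Submodule.span k (Set.range (X : Fin 3 → MvPolynomial (Fin 3) k)))
    (φ : Matrix (Fin 3) (Fin 2) (MvPolynomial (Fin 2) k))
    (hφ1 : φ 0 0 = X 0 ^ 2 ∧ φ 1 0 = X 0 * X 1 ∧ φ 2 0 = X 1 ^ 2)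
    (hφ2 : ∀ i, φ i 1 =
      C (coeff (Finsupp.single i 1) u) * X 0 ^ 2 +
      C (coeff (Finsupp.single i 1) v) * (X 0 * X 1) +
      C (coeff (Finsupp.single i 1) w) * X 1 ^ 2)
    (f : Fin 3 → MvPolynomial (Fin 2) k)
    (hf : ∀ j, f j = (-1) ^ (j : ℕ) * (φ.submatrix j.succAbove id).det)
    (I : Ideal (MvPolynomial (Fin 2) k)) (hI : I = Ideal.span (Set.range f))
    (hht : I.heightOf = 2)
    (hmin : ¬ ∃ g₁ g₂ : MvPolynomial (Fin 2) k, I = Ideal.span {g₁, g₂})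
    (hgen : (Ideal.span {X 0 * v - X 1 * u, X 0 * w - X 2 * u, X 1 * w - X 2 * v} :
      Ideal (MvPolynomial (Fin 3) k)).heightOf = 2) :
    RingHom.ker (reesPresentation k f) =
      Ideal.span {
        X 0 ^ 2 * X 2 + X 0 * X 1 * X 3 + X 1 ^ 2 * X 4,
        X 0 ^ 2 * toFive k u + X 0 * X 1 * toFive k v + X 1 ^ 2 * toFive k w,
        -(X 0 * X 3 * toFive k u) - X 1 * X 4 * toFive k u +
          X 0 * X 2 * toFive k v + X 1 * X 2 * toFive k w,
        -(X 0 * X 4 * toFive k u) - X 1 * X 4 * toFive k v +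
          X 0 * X 2 * toFive k w + X 1 * X 3 * toFive k w,
        toFive k (-(X 2 ^ 2 * u ^ 2) + X 1 * X 2 * u * v - X 0 * X 2 * v ^ 2
          - X 1 ^ 2 * u * w + 2 * (X 0 * X 2 * u * w) + X 0 * X 1 * v * w
          - X 0 ^ 2 * w ^ 2)} := by
  obtain ⟨ha₀, ha₁, ha₂⟩ := hφ1
  have hf₀ : f 0 = X 0 * X 1 * φ 2 1 - X 1 ^ 2 * φ 1 1 := by
    rw [hf, Matrix.det_fin_two]
    simp [ha₁, ha₂]
    ring
  have hf₁ : f 1 = X 1 ^ 2 * φ 0 1 - X 0 ^ 2 * φ 2 1 := by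
    rw [hf, Matrix.det_fin_two]
    simp [Fin.succAbove, ha₀, ha₂]
    ring
  have hf₂ : f 2 = X 0 ^ 2 * φ 1 1 - X 0 * X 1 * φ 0 1 := by
    rw [hf, Matrix.det_fin_two]
    simp [Fin.succAbove, ha₀, ha₁]
    ring
  have hφh (i) : (φ i 1).IsHomogeneous 2 := by
    have h₀ : ((X 0 : MvPolynomial (Fin 2) k) ^ 2).IsHomogeneous 2 := isHomogeneous_X_pow _ _
    have h₁ : ((X 0 : MvPolynomial (Fin 2) k) * X 1).IsHomogeneous 2 :=
      (isHomogeneous_X k 0).mul (isHomogeneous_X k 1)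
    have h₂ : ((X 1 : MvPolynomial (Fin 2) k) ^ 2).IsHomogeneous 2 := isHomogeneous_X_pow _ _
    rw [hφ2]
    exact ((h₀.C_mul _).add (h₁.C_mul _)).add (h₂.C_mul _)
  have hfh (i) : (f i).IsHomogeneous 4 := by
    have h₀ : ((X 0 : MvPolynomial (Fin 2) k) ^ 2).IsHomogeneous 2 := isHomogeneous_X_pow _ _
    have h₁ : ((X 0 : MvPolynomial (Fin 2) k) * X 1).IsHomogeneous 2 :=
      (isHomogeneous_X k 0).mul (isHomogeneous_X k 1)
    have h₂ : ((X 1 : MvPolynomial (Fin 2) k) ^ 2).IsHomogeneous 2 := isHomogeneous_X_pow _ _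
    fin_cases i
    · exact hf₀ ▸ (h₁.mul (hφh 2)).sub (h₂.mul (hφh 1))
    · exact hf₁ ▸ (h₂.mul (hφh 0)).sub (h₀.mul (hφh 2))
    · exact hf₂ ▸ (h₀.mul (hφh 1)).sub (h₁.mul (hφh 0))
  have hx : toFive k (X 0) = X 2 := toFive_X k 0
  have hy : toFive k (X 1) = X 3 := toFive_X k 1
  have hz : toFive k (X 2) = X 4 := toFive_X k 2
  let ι := rename (R := k) (Fin.castAdd (n := 2) 3)
  have hι₀ : ι (X 0) = X 0 := rename_X _ _
  have hι₁ : ι (X 1) = X 1 := rename_X _ _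
  set F₁ : MvPolynomial (Fin 5) k := X 0 ^ 2 * X 2 + X 0 * X 1 * X 3 + X 1 ^ 2 * X 4 with hF₁
  set F₂ : MvPolynomial (Fin 5) k :=
    X 0 ^ 2 * toFive k u + X 0 * X 1 * toFive k v + X 1 ^ 2 * toFive k w with hF₂
  have hF₂' : F₂ = ι (φ 0 1) * X 2 + ι (φ 1 1) * X 3 + ι (φ 2 1) * X 4 := by
    have hC (r : k) : toFive k (C r) = C r := rename_C _ _
    have hιC (r : k) : ι (C r) = C r := rename_C _ _
    have hlin {l} (hl : l ∈ Submodule.span k (Set.range (X : Fin 3 → MvPolynomial (Fin 3) k))) :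
        toFive k l = C (coeff (Finsupp.single 0 1) l) * X 2 +
          C (coeff (Finsupp.single 1 1) l) * X 3 + C (coeff (Finsupp.single 2 1) l) * X 4 := by
      conv_lhs => rw [eq_sum_coeff_mul_X hl]
      simp only [Fin.sum_univ_three, map_add, map_mul, hC, hx, hy, hz]
    rw [hF₂, hlin hu, hlin hv, hlin hw]
    simp only [hφ2, map_add, map_mul, map_pow, hιC, hι₀, hι₁]
    ring
  set a := X 0 * v - X 1 * u with ha
  set b := X 0 * w - X 2 * u with hb
  set c := X 1 * w - X 2 * v with hc
  have hιa : toFive k a = X 2 * toFive k v - X 3 * toFive k u := by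
    rw [ha, map_sub, map_mul, map_mul, hx, hy]
  have hιb : toFive k b = X 2 * toFive k w - X 4 * toFive k u := by
    rw [hb, map_sub, map_mul, map_mul, hx, hz]
  have hιc : toFive k c = X 3 * toFive k w - X 4 * toFive k v := by
    rw [hc, map_sub, map_mul, map_mul, hy, hz]
  have hh₁ : -(X 0 * X 3 * toFive k u) - X 1 * X 4 * toFive k u +
      X 0 * X 2 * toFive k v + X 1 * X 2 * toFive k w =
      X 0 * toFive k a + X 1 * toFive k b := by
    rw [hιa, hιb]; ring
  have hh₂ : -(X 0 * X 4 * toFive k u) - X 1 * X 4 * toFive k v +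
      X 0 * X 2 * toFive k w + X 1 * X 3 * toFive k w =
      X 0 * toFive k b + X 1 * toFive k c := by
    rw [hιb, hιc]; ring
  have hF : -(X 2 ^ 2 * u ^ 2) + X 1 * X 2 * u * v - X 0 * X 2 * v ^ 2
      - X 1 ^ 2 * u * w + 2 * (X 0 * X 2 * u * w) + X 0 * X 1 * v * w
      - X 0 ^ 2 * w ^ 2 = a * c - b ^ 2 := by
    rw [ha, hb, hc]; ring
  rw [hh₁, hh₂, hF]
  set h₁ := X 0 * toFive k a + X 1 * toFive k b with hh₁'
  set h₂ := X 0 * toFive k b + X 1 * toFive k c with hh₂'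
  set K := Ideal.span {F₁, F₂, h₁, h₂, toFive k (a * c - b ^ 2)} with hK
  have hQK : Ideal.span {F₁, F₂} ≤ K := by
    refine Ideal.span_mono ?_
    rintro x (rfl | rfl) <;> simp
  apply le_antisymm
  · intro p hp
    have hQ (i j : Fin 3) : rename (Fin.castAdd 3) (f i) * X (Fin.natAdd 2 j) -
        rename (Fin.castAdd 3) (f j) * X (Fin.natAdd 2 i) ∈ Ideal.span {F₁, F₂} := by
      have h0 : ι (f 0) = X 0 * X 1 * ι (φ 2 1) - X 1 ^ 2 * ι (φ 1 1) := by
        simp only [hf₀, map_sub, map_mul, map_pow, hι₀, hι₁]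
      have h1 : ι (f 1) = X 1 ^ 2 * ι (φ 0 1) - X 0 ^ 2 * ι (φ 2 1) := by
        simp only [hf₁, map_sub, map_mul, map_pow, hι₀, hι₁]
      have h2 : ι (f 2) = X 0 ^ 2 * ι (φ 1 1) - X 0 * X 1 * ι (φ 0 1) := by
        simp only [hf₂, map_sub, map_mul, map_pow, hι₀, hι₁]
      have h01 : ι (f 0) * X 3 - ι (f 1) * X 2 ∈ Ideal.span {F₁, F₂} :=
        Ideal.mem_span_pair.2 ⟨ι (φ 2 1), -X 1 ^ 2, by rw [hF₁, hF₂', h0, h1]; ring⟩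
      have h02 : ι (f 0) * X 4 - ι (f 2) * X 2 ∈ Ideal.span {F₁, F₂} :=
        Ideal.mem_span_pair.2 ⟨-ι (φ 1 1), X 0 * X 1, by rw [hF₁, hF₂', h0, h2]; ring⟩
      have h12 : ι (f 1) * X 4 - ι (f 2) * X 3 ∈ Ideal.span {F₁, F₂} :=
        Ideal.mem_span_pair.2 ⟨ι (φ 0 1), -X 0 ^ 2, by rw [hF₁, hF₂', h1, h2]; ring⟩
      fin_cases i <;> fin_cases j
      · simp
      · exact h01
      · exact h02
      · exact neg_sub (ι (f 0) * X 3) _ ▸ neg_mem h01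
      · simp
      · exact h12
      · exact neg_sub (ι (f 0) * X 4) _ ▸ neg_mem h02
      · exact neg_sub (ι (f 1) * X 4) _ ▸ neg_mem h12
      · simp
    let J : Ideal (MvPolynomial (Fin 2) k) :=
      ((Ideal.span {F₁, F₂}).colon {p}).comap ι
    have hJ (q) : q ∈ J ↔ ι q * p ∈ Ideal.span {F₁, F₂} := by
      simp [J, Submodule.mem_colon_singleton]
    have hIJ : I ≤ J.radical := by
      rw [hI, Ideal.span_le]
      rintro _ ⟨i, rfl⟩
      obtain ⟨n, hn⟩ := exists_pow_mul_mem_of_mem_ker_reesPresentation hQ hp i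
      exact ⟨n, (hJ _).2 (by rwa [map_pow])⟩
    have hrad (i : Fin 2) : X i ∈ J.radical :=
      (Ideal.radical_le_radical_iff.2 hIJ) (hI ▸ X_mem_radical_span_of_heightOf_eq_two hfh (hI ▸ hht) i)
    obtain ⟨n, hn⟩ := hrad 0
    obtain ⟨m, hm⟩ := hrad 1
    rw [hJ, map_pow, hι₀] at hn
    rw [hJ, map_pow, hι₁] at hm
    have hsat (N : ℕ) (h : ∀ i j, i + j = N → X 0 ^ i * X 1 ^ j * p ∈ K) : p ∈ K := by
      induction N with
      | zero => simpa using h 0 0 rfl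
      | succ N ih =>
        refine ih fun i j hij => mem_span_of_X_mul_mem ha hb hc
          (fun d => Ideal.isUnit_of_dvd_of_heightOf_eq_two hgen) hh₁' hh₂' hF₁ hF₂ ?_ ?_
        · have := h (i + 1) j (by lia)
          rwa [pow_succ', mul_assoc, mul_assoc, ← mul_assoc _ _ p] at this
        · have := h i (j + 1) (by lia)
          rwa [pow_succ', mul_left_comm, mul_assoc] at this
    refine hsat (n + m) fun i j hij => hQK ?_
    rcases le_or_gt n i with hi | hi
    · obtain ⟨d, rfl⟩ := Nat.exists_eq_add_of_le hi
      convert Ideal.mul_mem_left _ (X 0 ^ d * X 1 ^ j) hn using 1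
      ring
    · obtain ⟨d, rfl⟩ := Nat.exists_eq_add_of_le (show m ≤ j by lia)
      convert Ideal.mul_mem_left _ (X 0 ^ i * X 1 ^ d) hm using 1
      ring
  · have hker : (RingHom.ker (reesPresentation k f)).IsPrime := RingHom.ker_isPrime _
    have hΨ₀ : reesPresentation k f (X 0) = Polynomial.C (X 0) := by simp [reesPresentation]
    have hΨ₁ : reesPresentation k f (X 1) = Polynomial.C (X 1) := by simp [reesPresentation]
    have hΨ₂ : reesPresentation k f (X 2) = Polynomial.C (f 0) * Polynomial.X := by
      simp [reesPresentation]
    have hΨ₃ : reesPresentation k f (X 3) = Polynomial.C (f 1) * Polynomial.X := by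
      simp [reesPresentation]
    have hΨ₄ : reesPresentation k f (X 4) = Polynomial.C (f 2) * Polynomial.X := by
      simp [reesPresentation]
    have hΨι (q) : reesPresentation k f (ι q) = Polynomial.C q := by
      have : (reesPresentation k f).comp ι = Polynomial.CAlgHom := by
        ext i : 1
        fin_cases i
        · exact (congrArg _ hι₀).trans hΨ₀
        · exact (congrArg _ hι₁).trans hΨ₁
      exact DFunLike.congr_fun this q
    have hs : X 0 ∉ RingHom.ker (reesPresentation k f) := by
      simp [RingHom.mem_ker, hΨ₀]
    have ht : X 1 ∉ RingHom.ker (reesPresentation k f) := by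
      simp [RingHom.mem_ker, hΨ₁]
    have m₁ : F₁ ∈ RingHom.ker (reesPresentation k f) := by
      rw [RingHom.mem_ker, hF₁]
      simp only [map_add, map_mul, map_pow, hΨ₀, hΨ₁, hΨ₂, hΨ₃, hΨ₄, hf₀, hf₁, hf₂, map_sub]
      ring
    have m₂ : F₂ ∈ RingHom.ker (reesPresentation k f) := by
      rw [RingHom.mem_ker, hF₂']
      simp only [map_add, map_mul, map_pow, hΨι, hΨ₂, hΨ₃, hΨ₄, hf₀, hf₁, hf₂, map_sub]
      ring
    have m₃ : h₁ ∈ RingHom.ker (reesPresentation k f) := by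
      refine (hker.mem_or_mem (?_ : X 1 * h₁ ∈ _)).resolve_left ht
      convert sub_mem (Ideal.mul_mem_left _ (X 2) m₂) (Ideal.mul_mem_left _ (toFive k u) m₁) using 1
      rw [hh₁', hF₁, hF₂, hιa, hιb]; ring
    have m₄ : h₂ ∈ RingHom.ker (reesPresentation k f) := by
      refine (hker.mem_or_mem (?_ : X 0 * h₂ ∈ _)).resolve_left hs
      convert sub_mem (Ideal.mul_mem_left _ (toFive k w) m₁) (Ideal.mul_mem_left _ (X 4) m₂) using 1
      rw [hh₂', hF₁, hF₂, hιb, hιc]; ring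
    have m₅ : toFive k (a * c - b ^ 2) ∈ RingHom.ker (reesPresentation k f) := by
      refine (hker.mem_or_mem (?_ : X 0 * toFive k (a * c - b ^ 2) ∈ _)).resolve_left hs
      convert sub_mem (Ideal.mul_mem_left _ (toFive k c) m₃)
        (Ideal.mul_mem_left _ (toFive k b) m₄) using 1
      rw [hh₁', hh₂', map_sub, map_mul, map_pow]; ring
    rw [hK, Ideal.span_le]
    rintro x (rfl | rfl | rfl | rfl | rfl)
    exacts [m₁, m₂, m₃, m₄, m₅]
end

section
/- Let k be an infinite field, R = k[s,t], and let I ⊂ R be a height-2 ideal minimally generated by three forms of degree 4 whose Hilbert–Burch matrix has columns of degrees 1 and 3. In S = R[T_1, T_2, T_3], write the two defining equations of Sym(I) as f = a s + b t and g = c s + d t, where a, b are k-linear forms in T_1, T_2, T_3 and c = x s^2 + y st + z t^2, d = u s^2 + v st + w t^2 with x, y, z, u, v, w k-linear forms in T_1, T_2, T_3. Set h_1 = ad − bc = (au − bx)s^2 + (av − by)st + (aw − bz)t^2, h_2 = (b^2x − abu)s + (b^2y − abz − abv + a^2w)t, and h_3 = −b^3x + ab^2y − a^2bz + ab^2u −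 a^2bv + a^3w. Then the defining ideal of the Rees algebra R[It] in S equals (f, g, h_1, h_2, h_3), and h_3 is the elimination equation. -/
open MvPolynomial

theorem MvPolynomial.eval₂_const_mul_of_isHomogeneous {σ S T : Type*} [CommSemiring S]
    [CommSemiring T] {p : MvPolynomial σ S} {n : ℕ} (hp : p.IsHomogeneous n) (g : S →+* T)
    (v : σ → T) (r : T) :
    eval₂ g (fun i => r * v i) p = r ^ n * eval₂ g v p := by
  rw [eval₂_eq, eval₂_eq, Finset.mul_sum]
  refine Finset.sum_congr rfl fun d hd => ?_
  have hdeg : ∑ i ∈ d.support, d i = n := (hp.degree_eq_sum_deg_support hd).symm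
  simp only [mul_pow, Finset.prod_mul_distrib, Finset.prod_pow_eq_pow_sum, hdeg]
  ring

theorem MvPolynomial.dvd_eval₂_sub_eval₂ {σ S T : Type*} [CommSemiring S] [CommRing T]
    (g : S →+* T) {v w : σ → T} {r : T} (h : ∀ i, r ∣ v i - w i) (p : MvPolynomial σ S) :
    r ∣ eval₂ g v p - eval₂ g w p := by
  rw [← Ideal.mem_span_singleton, ← Ideal.Quotient.mk_eq_mk_iff_sub_mem, hom_eval₂, hom_eval₂]
  congr 1
  funext i
  simpa [Ideal.Quotient.mk_eq_mk_iff_sub_mem, Ideal.mem_span_singleton] using h i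

theorem MvPolynomial.homogeneousComponent_add_mul {σ S : Type*} [CommSemiring S]
    {p : MvPolynomial σ S} {d : ℕ} (hp : p.IsHomogeneous d) (l : ℕ) (q : MvPolynomial σ S) :
    homogeneousComponent (l + d) (p * q) = p * homogeneousComponent l q := by
  conv_lhs => rw [← sum_homogeneousComponent q, Finset.mul_sum, map_sum]
  have key : ∀ i, homogeneousComponent (l + d) (p * homogeneousComponent i q) =
      if l = i then p * homogeneousComponent i q else 0 := by
    intro i
    have := hp.mul (homogeneousComponent_isHomogeneous i q)
    rw [homogeneousComponent_of_mem this]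
    simp [add_comm d i]
  simp only [key, Finset.sum_ite_eq, Finset.mem_range]
  split_ifs with h
  · rfl
  · rw [homogeneousComponent_eq_zero _ _ (by omega), mul_zero]

theorem MvPolynomial.mem_pow_idealOfVars_iff_homogeneousComponent {σ S : Type*} [CommSemiring S]
    (n : ℕ) (p : MvPolynomial σ S) :
    p ∈ idealOfVars σ S ^ n ↔ ∀ l < n, homogeneousComponent l p = 0 := by
  rw [mem_pow_idealOfVars_iff']
  constructor
  · intro h l hl
    ext d
    rw [coeff_homogeneousComponent]
    split_ifs with hd
    · simpa using h d (hd ▸ hl)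
    · simp
  · intro h d hd
    simpa [coeff_homogeneousComponent] using congrArg (coeff d) (h _ hd)

theorem MvPolynomial.IsHomogeneous.mem_pow_idealOfVars {σ S : Type*} [CommSemiring S]
    {p : MvPolynomial σ S} {d : ℕ} (hp : p.IsHomogeneous d) : p ∈ idealOfVars σ S ^ d := by
  rw [mem_pow_idealOfVars_iff']
  exact fun x hx => hp.coeff_eq_zero hx.ne

theorem MvPolynomial.mem_pow_idealOfVars_of_mul_mem {σ S : Type*} [CommRing S] [IsDomain S]
    {p : MvPolynomial σ S} {d : ℕ} (hp : p.IsHomogeneous d) (hp0 : p ≠ 0) {n : ℕ}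
    {q : MvPolynomial σ S} (h : p * q ∈ idealOfVars σ S ^ n) : q ∈ idealOfVars σ S ^ (n - d) := by
  rw [mem_pow_idealOfVars_iff_homogeneousComponent] at h ⊢
  intro l hl
  have := h (l + d) (by omega)
  rw [homogeneousComponent_add_mul hp] at this
  exact (mul_eq_zero.1 this).resolve_left hp0

/-- If the coefficients of `(X P - Q) Y` lie in the `n`-th power of the irrelevant ideal, with `P`
a nonzero form of degree `d` and `Q` of order at least `d`, then those of `Y` lie in the
`(n - d)`-th power. -/
theorem MvPolynomial.coeff_mem_pow_idealOfVars_of_mul {σ S : Type*} [CommRing S] [IsDomain S]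
    {P Q : MvPolynomial σ S} {d : ℕ} (hP : P.IsHomogeneous d) (hP0 : P ≠ 0)
    (hQ : Q ∈ idealOfVars σ S ^ d) {n : ℕ} {Y : Polynomial (MvPolynomial σ S)}
    (h : ∀ j, ((Polynomial.X * Polynomial.C P - Polynomial.C Q) * Y).coeff j ∈
      idealOfVars σ S ^ n) (j : ℕ) :
    Y.coeff j ∈ idealOfVars σ S ^ (n - d) := by
  rcases le_total n d with hnd | hnd
  · simp [Nat.sub_eq_zero_of_le hnd]
  have hmul : ∀ i, ((Polynomial.X * Polynomial.C P - Polynomial.C Q) * Y).coeff (i + 1) =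
      P * Y.coeff i - Q * Y.coeff (i + 1) := by
    intro i
    rw [sub_mul, Polynomial.coeff_sub, mul_assoc, Polynomial.coeff_X_mul, Polynomial.coeff_C_mul,
      Polynomial.coeff_C_mul]
  have key : ∀ m i, Y.natDegree < i + m → Y.coeff i ∈ idealOfVars σ S ^ (n - d) := by
    intro m
    induction m with
    | zero =>
      intro i hi
      simp [Polynomial.coeff_eq_zero_of_natDegree_lt (show Y.natDegree < i by simpa using hi)]
    | succ m ih =>
      intro i hi
      have h1 := ih (i + 1) (by omega)
      have h2 : Q * Y.coeff (i + 1) ∈ idealOfVars σ S ^ n := by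
        have := Ideal.mul_mem_mul hQ h1
        rwa [← pow_add, Nat.add_sub_cancel' hnd] at this
      have h3 := h (i + 1)
      rw [hmul] at h3
      refine mem_pow_idealOfVars_of_mul_mem hP hP0 ?_
      simpa using Ideal.add_mem _ h3 h2
  exact key (Y.natDegree + 1) j (by omega)

/-- A form in two variables vanishing at `(-b, a)`, with `a` and `b` relatively prime, is a
multiple of the linear form `a X₀ + b X₁`. -/
theorem MvPolynomial.dvd_of_eval_eq_zero {A : Type*} [CommRing A] [IsDomain A]
    [UniqueFactorizationMonoid A] {a b : A} (hab : IsRelPrime a b) (ha : a ≠ 0)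
    {p : MvPolynomial (Fin 2) A} {m : ℕ} (hp : p.IsHomogeneous m) (h : eval ![-b, a] p = 0) :
    C a * X 0 + C b * X 1 ∣ p := by
  have h1 : eval₂ C (fun i => C a * X i) p = C a ^ m * p := by
    rw [eval₂_const_mul_of_isHomogeneous hp, eval₂_eta]
  have h2 : eval₂ C (fun i => X 1 * C (![-b, a] i)) p = (0 : MvPolynomial (Fin 2) A) := by
    rw [eval₂_const_mul_of_isHomogeneous hp (C : A →+* MvPolynomial (Fin 2) A)
      (fun i => C (![-b, a] i)) (X 1)]
    have : eval₂ C (fun i => C (![-b, a] i)) p =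
        (C (eval ![-b, a] p) : MvPolynomial (Fin 2) A) := by
      rw [eval, coe_eval₂Hom, hom_eval₂]; rfl
    rw [this, h, C_0, mul_zero]
  have h3 : C a * X 0 + C b * X 1 ∣ eval₂ C (fun i => C a * X i) p -
      eval₂ C (fun i => X 1 * C (![-b, a] i)) p := by
    refine dvd_eval₂_sub_eval₂ _ (fun i => ?_) p
    fin_cases i
    · exact ⟨1, by simp; ring⟩
    · exact ⟨0, by simp; ring⟩
  rw [h1, h2, sub_zero] at h3
  refine IsRelPrime.dvd_of_dvd_mul_left (IsRelPrime.pow_right ?_) h3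
  intro d hd1 hd2
  obtain ⟨e, he, rfl⟩ := (dvd_C_iff_exists ha).1 hd2
  have h4 : (C e : MvPolynomial (Fin 2) A) ∣ C b * X 1 :=
    (dvd_add_right (hd2.mul_right (X 0))).1 hd1
  have h5 : e ∣ b := by
    simpa using (C_dvd_iff_dvd_coeff _ _).1 h4 (Finsupp.single 1 1)
  exact (hab he h5).map C

section ReesAlgebra

variable {k : Type*} [Field k]

/-- The coordinate change `Tᵢ ↦ (αᵢ t - βᵢ s) + γᵢ c` from `k[T₁,T₂,T₃]` to `k[s,t][c]`. -/
noncomputable def coordHom (α β γ : Fin 3 → k) :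
    MvPolynomial (Fin 3) k →ₐ[k] Polynomial (MvPolynomial (Fin 2) k) :=
  aeval fun i =>
    Polynomial.C (C (α i) * X 1 - C (β i) * X 0) + Polynomial.X * Polynomial.C (C (γ i))

/-- The map `Tᵢ ↦ fᵢ T` from `k[T₁,T₂,T₃]` to `k[s,t][T]`. -/
noncomputable def reesHom (f : Fin 3 → MvPolynomial (Fin 2) k) :
    MvPolynomial (Fin 3) k →ₐ[k] Polynomial (MvPolynomial (Fin 2) k) :=
  aeval fun i => Polynomial.X * Polynomial.C (f i)

/-- The presentation of the Rees algebra with `k[s,t,T₁,T₂,T₃]` viewed as `k[T₁,T₂,T₃][s,t]`. -/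
noncomputable def reesHomIterated (f : Fin 3 → MvPolynomial (Fin 2) k) :
    MvPolynomial (Fin 2) (MvPolynomial (Fin 3) k) →+* Polynomial (MvPolynomial (Fin 2) k) :=
  eval₂Hom (reesHom f : MvPolynomial (Fin 3) k →+* Polynomial (MvPolynomial (Fin 2) k))
    fun j => Polynomial.C (X j)

/-- The retraction of `coordHom` sending `s ↦ -b`, `t ↦ a`. -/
noncomputable def coordRetraction (a b c : MvPolynomial (Fin 3) k) :
    Polynomial (MvPolynomial (Fin 2) k) →+* MvPolynomial (Fin 3) k :=
  Polynomial.eval₂RingHom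
    (aeval ![-b, a] : MvPolynomial (Fin 2) k →ₐ[k] MvPolynomial (Fin 3) k).toRingHom c

theorem coordRetraction_coordHom {α β γ : Fin 3 → k} {a b c : MvPolynomial (Fin 3) k}
    (hX : ∀ i, X i = C (α i) * a + C (β i) * b + C (γ i) * c) (q : MvPolynomial (Fin 3) k) :
    coordRetraction a b c (coordHom α β γ q) = q := by
  have : (coordRetraction a b c).comp (coordHom α β γ).toRingHom = RingHom.id _ := by
    refine ringHom_ext (fun r => ?_) fun i => ?_
    · simp [coordRetraction, coordHom, algebraMap_eq, Polynomial.algebraMap_apply]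
    · conv_rhs => rw [RingHom.id_apply, hX i]
      simp [coordRetraction, coordHom, algebraMap_eq]
  exact congrArg (fun F => F q) this

theorem aeval_homogeneousComponent {d : ℕ} (hd : 0 < d) {f : Fin 3 → MvPolynomial (Fin 2) k}
    (hf : ∀ i, (f i).IsHomogeneous d) (n : ℕ) (q : MvPolynomial (Fin 3) k) :
    aeval f (homogeneousComponent n q) = homogeneousComponent (d * n) (aeval f q) := by
  conv_rhs => rw [← sum_homogeneousComponent q, map_sum, map_sum]
  have key : ∀ i, homogeneousComponent (d * n) (aeval f (homogeneousComponent i q)) =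
      if n = i then aeval f (homogeneousComponent i q) else 0 := by
    intro i
    have := (homogeneousComponent_isHomogeneous i q).aeval f hf
    rw [homogeneousComponent_of_mem this]
    simp [hd.ne']
  simp only [key, Finset.sum_ite_eq, Finset.mem_range]
  split_ifs with h
  · rfl
  · rw [homogeneousComponent_eq_zero _ _ (by omega), map_zero]

theorem reesHom_of_isHomogeneous (f : Fin 3 → MvPolynomial (Fin 2) k) {n : ℕ}
    {q : MvPolynomial (Fin 3) k} (hq : q.IsHomogeneous n) :
    reesHom f q = Polynomial.X ^ n * Polynomial.C (aeval f q) := by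
  rw [reesHom, aeval_def, eval₂_const_mul_of_isHomogeneous hq, aeval_def, hom_eval₂]
  rfl

theorem coeff_reesHom (f : Fin 3 → MvPolynomial (Fin 2) k) (n : ℕ) (q : MvPolynomial (Fin 3) k) :
    (reesHom f q).coeff n = aeval f (homogeneousComponent n q) := by
  conv_lhs => rw [← sum_homogeneousComponent q, map_sum, Polynomial.finsetSum_coeff]
  have key : ∀ i, (reesHom f (homogeneousComponent i q)).coeff n =
      if n = i then aeval f (homogeneousComponent i q) else 0 := by
    intro i
    rw [reesHom_of_isHomogeneous f (homogeneousComponent_isHomogeneous i q),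
      mul_comm, Polynomial.coeff_C_mul_X_pow]
  simp only [key, Finset.sum_ite_eq, Finset.mem_range]
  split_ifs with h
  · rfl
  · rw [homogeneousComponent_eq_zero _ _ (by omega), map_zero]

theorem aeval_eq_zero_of_reesHom_eq_zero {f : Fin 3 → MvPolynomial (Fin 2) k}
    {q : MvPolynomial (Fin 3) k} (h : reesHom f q = 0) : aeval f q = 0 := by
  rw [← sum_homogeneousComponent q, map_sum]
  refine Finset.sum_eq_zero fun i _ => ?_
  rw [← coeff_reesHom, h, Polynomial.coeff_zero]

theorem coeff_reesHomIterated_homogeneousComponent {d : ℕ} {f : Fin 3 → MvPolynomial (Fin 2) k}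
    (hf : ∀ i, (f i).IsHomogeneous d) (m n : ℕ)
    (θ : MvPolynomial (Fin 2) (MvPolynomial (Fin 3) k)) :
    (reesHomIterated f (homogeneousComponent m θ)).coeff n =
      homogeneousComponent (m + d * n) ((reesHomIterated f θ).coeff n) := by
  induction θ using MvPolynomial.induction_on' with
  | add p q hp hq => simp only [map_add, Polynomial.coeff_add, hp, hq]
  | monomial e r =>
    have hval : (reesHomIterated f (monomial e r)).coeff n =
        (monomial e (1 : k)) * aeval f (homogeneousComponent n r) := by
      have h1 : reesHomIterated f (monomial e r) = Polynomial.C (monomial e (1 : k)) * reesHom f r := by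
        simp [reesHomIterated, monomial_eq, Finsupp.prod_fintype, mul_comm]
      rw [h1, Polynomial.coeff_C_mul, coeff_reesHom]
    have hhom : ((reesHomIterated f (monomial e r)).coeff n).IsHomogeneous (e.degree + d * n) := by
      rw [hval]
      exact (isHomogeneous_monomial _ rfl).mul ((homogeneousComponent_isHomogeneous n r).aeval f hf)
    rw [homogeneousComponent_of_mem (isHomogeneous_monomial r rfl), homogeneousComponent_of_mem hhom]
    simp only [Nat.add_right_cancel_iff]
    split_ifs <;> simp

theorem reesHomIterated_homogeneousComponent_eq_zero {d : ℕ} {f : Fin 3 → MvPolynomial (Fin 2) k}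
    (hf : ∀ i, (f i).IsHomogeneous d) {θ : MvPolynomial (Fin 2) (MvPolynomial (Fin 3) k)}
    (h : reesHomIterated f θ = 0) (m : ℕ) :
    reesHomIterated f (homogeneousComponent m θ) = 0 := by
  ext1 n
  rw [coeff_reesHomIterated_homogeneousComponent hf, h, Polynomial.coeff_zero, map_zero]

theorem isRelPrime_X_mul_C_sub_C {P Q : MvPolynomial (Fin 2) k} (hPQ : IsRelPrime P Q)
    (hP : P ≠ 0) :
    IsRelPrime (Polynomial.X * Polynomial.C P - Polynomial.C Q) (Polynomial.C P) := by
  intro r hr1 hr2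
  have hr0 : r.natDegree = 0 := by
    have := Polynomial.natDegree_le_of_dvd hr2 (Polynomial.C_ne_zero.2 hP)
    simpa using this
  rw [Polynomial.eq_C_of_natDegree_eq_zero hr0] at hr1 hr2 ⊢
  have h2 : r.coeff 0 ∣ P := by simpa using (Polynomial.C_dvd_iff_dvd_coeff _ _).1 hr2 0
  have h1 : r.coeff 0 ∣ Q := by simpa using (Polynomial.C_dvd_iff_dvd_coeff _ _).1 hr1 0
  exact (hPQ h2 h1).map Polynomial.C

theorem dvd_of_aeval_eq_zero {α β γ : Fin 3 → k} {a b c h : MvPolynomial (Fin 3) k}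
    (hX : ∀ i, X i = C (α i) * a + C (β i) * b + C (γ i) * c)
    {P Q : MvPolynomial (Fin 2) k} (hPQ : IsRelPrime P Q) (hP : P ≠ 0)
    (hh : coordHom α β γ h = Polynomial.X * Polynomial.C P - Polynomial.C Q)
    {d : ℕ} (hd : 0 < d) {f : Fin 3 → MvPolynomial (Fin 2) k} (hf : ∀ i, (f i).IsHomogeneous d)
    (hfeq : ∀ i, f i = P * (C (α i) * X 1 - C (β i) * X 0) + Q * C (γ i))
    {q : MvPolynomial (Fin 3) k} (hq : aeval f q = 0) : h ∣ q := by
  have key : ∀ n, coordHom α β γ h ∣ coordHom α β γ (homogeneousComponent n q) := by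
    intro n
    rw [hh]
    have hhom := homogeneousComponent_isHomogeneous n q
    have hqn : aeval f (homogeneousComponent n q) = 0 := by
      rw [aeval_homogeneousComponent hd hf, hq, map_zero]
    set p := homogeneousComponent n q
    set g := algebraMap k (Polynomial (MvPolynomial (Fin 2) k))
    set ν : Fin 3 → Polynomial (MvPolynomial (Fin 2) k) := fun i =>
      Polynomial.C (C (α i) * X 1 - C (β i) * X 0) + Polynomial.X * Polynomial.C (C (γ i)) with hν
    have h1 : eval₂ g (fun i => Polynomial.C P * ν i) p = Polynomial.C P ^ n * coordHom α β γ p :=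
      eval₂_const_mul_of_isHomogeneous hhom g ν _
    have h2 : eval₂ g (fun i => Polynomial.C (f i)) p = 0 := by
      have : eval₂ g (fun i => Polynomial.C (f i)) p = Polynomial.C (aeval f p) := by
        rw [aeval_def, hom_eval₂]; rfl
      rw [this, hqn, Polynomial.C_0]
    have h3 : Polynomial.X * Polynomial.C P - Polynomial.C Q ∣
        eval₂ g (fun i => Polynomial.C P * ν i) p - eval₂ g (fun i => Polynomial.C (f i)) p := by
      refine dvd_eval₂_sub_eval₂ g (fun i => ⟨Polynomial.C (C (γ i)), ?_⟩) p
      simp only [hν, hfeq, Polynomial.C_add, Polynomial.C_mul, Polynomial.C_sub]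
      ring
    rw [h1, h2, sub_zero] at h3
    exact IsRelPrime.dvd_of_dvd_mul_left (isRelPrime_X_mul_C_sub_C hPQ hP).pow_right h3
  have hdvd : coordHom α β γ h ∣ coordHom α β γ q := by
    rw [← sum_homogeneousComponent q, map_sum]
    exact Finset.dvd_sum fun n _ => key n
  simpa only [coordRetraction_coordHom hX] using map_dvd (coordRetraction a b c) hdvd

theorem reesHom_eval_of_isHomogeneous {f : Fin 3 → MvPolynomial (Fin 2) k}
    {a b : MvPolynomial (Fin 3) k} {E : Polynomial (MvPolynomial (Fin 2) k)}
    (ha : reesHom f a = E * Polynomial.C (X 1)) (hb : reesHom f b = -(E * Polynomial.C (X 0)))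
    {m : ℕ} {θ : MvPolynomial (Fin 2) (MvPolynomial (Fin 3) k)} (hθ : θ.IsHomogeneous m) :
    reesHom f (eval ![-b, a] θ) = E ^ m * reesHomIterated f θ := by
  rw [reesHomIterated, coe_eval₂Hom, ← eval₂_const_mul_of_isHomogeneous hθ, eval, coe_eval₂Hom,
    ← RingHom.coe_coe (reesHom f), hom_eval₂, RingHom.comp_id]
  congr 1
  funext i
  fin_cases i <;> simp [ha, hb]

theorem isRelPrime_of_coordHom {α β γ : Fin 3 → k} {a b c : MvPolynomial (Fin 3) k}
    (hX : ∀ i, X i = C (α i) * a + C (β i) * b + C (γ i) * c)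
    (ha : coordHom α β γ a = Polynomial.C (X 1))
    (hb : coordHom α β γ b = -Polynomial.C (X 0 : MvPolynomial (Fin 2) k)) :
    IsRelPrime a b := by
  intro r hra hrb
  have h1 : coordHom α β γ r ∣ Polynomial.C (X 1) := ha ▸ map_dvd (coordHom α β γ) hra
  have h0 : coordHom α β γ r ∣ Polynomial.C (X 0) := by
    have := map_dvd (coordHom α β γ) hrb
    rw [hb] at this
    exact (dvd_neg (α := Polynomial (MvPolynomial (Fin 2) k))).1 this
  have hrel : IsRelPrime (Polynomial.C (X 1 : MvPolynomial (Fin 2) k)) (Polynomial.C (X 0)) := by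
    have hprime := Polynomial.prime_C_iff.2 (X_prime (R := k) (i := (1 : Fin 2)))
    rw [hprime.irreducible.isRelPrime_iff_not_dvd, Polynomial.C_dvd_iff_dvd_coeff]
    intro h
    have := h 0
    simp [X_dvd_X] at this
  have := (hrel h1 h0).map (coordRetraction a b c)
  rwa [coordRetraction_coordHom hX] at this

theorem mem_span_pow_of_mul_mem {α β γ : Fin 3 → k} {a b c h : MvPolynomial (Fin 3) k}
    (hX : ∀ i, X i = C (α i) * a + C (β i) * b + C (γ i) * c)
    (ha : coordHom α β γ a = Polynomial.C (X 1))
    (hb : coordHom α β γ b = -Polynomial.C (X 0 : MvPolynomial (Fin 2) k))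
    {P Q : MvPolynomial (Fin 2) k} {d : ℕ} (hPd : P.IsHomogeneous d) (hP : P ≠ 0)
    (hQ : Q ∈ idealOfVars (Fin 2) k ^ d)
    (hh : coordHom α β γ h = Polynomial.X * Polynomial.C P - Polynomial.C Q)
    {n : ℕ} {q : MvPolynomial (Fin 3) k} (hq : h * q ∈ Ideal.span (Set.range ![-b, a]) ^ n) :
    q ∈ Ideal.span (Set.range ![-b, a]) ^ (n - d) := by
  have hrange : (coordHom α β γ) '' Set.range ![-b, a] =
      Polynomial.C '' Set.range (X : Fin 2 → MvPolynomial (Fin 2) k) := by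
    rw [← Set.range_comp, ← Set.range_comp]
    congr 1
    funext i
    fin_cases i <;> simp [ha, hb]
  have hrange' : (coordRetraction a b c) ''
      (Polynomial.C '' Set.range (X : Fin 2 → MvPolynomial (Fin 2) k)) =
      Set.range ![-b, a] := by
    rw [← Set.range_comp, ← Set.range_comp]
    congr 1
    funext i
    simp [coordRetraction]
  have h1 := Ideal.mem_map_of_mem (coordHom α β γ) hq
  rw [Ideal.map_pow, Ideal.map_span, hrange, ← Ideal.map_span, ← Ideal.map_pow,
    Ideal.mem_map_C_iff, map_mul, hh] at h1
  have h2 := coeff_mem_pow_idealOfVars_of_mul hPd hP hQ h1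
  rw [← Ideal.mem_map_C_iff] at h2
  have h3 := Ideal.mem_map_of_mem (coordRetraction a b c) h2
  rwa [idealOfVars, Ideal.map_pow, Ideal.map_span, Ideal.map_pow, Ideal.map_span, hrange',
    coordRetraction_coordHom hX] at h3

/-- An ideal of `k[T₁,T₂,T₃][s,t]` containing the linear form `a s + b t` and forms `W j` of
degrees `0,…,d` in `s,t`, all taking the value `h` at `(-b, a)`, contains the kernel of the
presentation of the Rees algebra. -/
theorem mem_of_reesHomIterated_eq_zero {α β γ : Fin 3 → k} {a b c h : MvPolynomial (Fin 3) k}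
    (hX : ∀ i, X i = C (α i) * a + C (β i) * b + C (γ i) * c)
    (ha : coordHom α β γ a = Polynomial.C (X 1))
    (hb : coordHom α β γ b = -Polynomial.C (X 0 : MvPolynomial (Fin 2) k))
    {P Q : MvPolynomial (Fin 2) k} (hPQ : IsRelPrime P Q) (hP : P ≠ 0)
    {d : ℕ} (hPd : P.IsHomogeneous d) (hQ : Q.IsHomogeneous (d + 1))
    (hh : coordHom α β γ h = Polynomial.X * Polynomial.C P - Polynomial.C Q)
    {f : Fin 3 → MvPolynomial (Fin 2) k}
    (hfeq : ∀ i, f i = P * (C (α i) * X 1 - C (β i) * X 0) + Q * C (γ i))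
    {E : Polynomial (MvPolynomial (Fin 2) k)}
    (hfa : reesHom f a = E * Polynomial.C (X 1)) (hfb : reesHom f b = -(E * Polynomial.C (X 0)))
    {J : Ideal (MvPolynomial (Fin 2) (MvPolynomial (Fin 3) k))}
    (hF : C a * X 0 + C b * X 1 ∈ J)
    (W : ℕ → MvPolynomial (Fin 2) (MvPolynomial (Fin 3) k)) (hWJ : ∀ j ≤ d, W j ∈ J)
    (hWd : ∀ j ≤ d, (W j).IsHomogeneous j) (hWh : ∀ j ≤ d, eval ![-b, a] (W j) = h)
    {θ : MvPolynomial (Fin 2) (MvPolynomial (Fin 3) k)} (hθ : reesHomIterated f θ = 0) :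
    θ ∈ J := by
  have hf : ∀ i, (f i).IsHomogeneous (d + 1) := by
    intro i
    rw [hfeq]
    refine (hPd.mul ?_).add ?_
    · exact (isHomogeneous_C_mul_X _ _).sub (isHomogeneous_C_mul_X _ _)
    · simpa using hQ.mul (isHomogeneous_C _ (γ i))
  have ha0 : a ≠ 0 := by
    rintro rfl
    rw [map_zero, eq_comm, Polynomial.C_eq_zero] at ha
    exact X_ne_zero _ ha
  have hab := isRelPrime_of_coordHom hX ha hb
  rw [← sum_homogeneousComponent θ]
  refine Ideal.sum_mem _ fun m _ => ?_
  have hpd := homogeneousComponent_isHomogeneous m θ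
  have hp := reesHomIterated_homogeneousComponent_eq_zero hf hθ m
  set p := homogeneousComponent m θ
  have hev : reesHom f (eval ![-b, a] p) = 0 := by
    rw [reesHom_eval_of_isHomogeneous hfa hfb hpd, hp, mul_zero]
  obtain ⟨q, hq⟩ := dvd_of_aeval_eq_zero hX hPQ hP hh d.succ_pos hf hfeq
    (aeval_eq_zero_of_reesHom_eq_zero hev)
  obtain ⟨r, hrd, hr⟩ : ∃ r : MvPolynomial (Fin 2) (MvPolynomial (Fin 3) k),
      r.IsHomogeneous (m - d) ∧ eval ![-b, a] r = q := by
    rw [← Ideal.mem_span_pow_iff_exists_isHomogeneous]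
    refine mem_span_pow_of_mul_mem hX ha hb hPd hP ?_ hh ?_
    · exact Ideal.pow_le_pow_right d.le_succ hQ.mem_pow_idealOfVars
    · rw [← hq, Ideal.mem_span_pow_iff_exists_isHomogeneous]
      exact ⟨p, hpd, rfl⟩
  have hle : min m d ≤ d := min_le_right _ _
  have hdiff : C a * X 0 + C b * X 1 ∣ p - W (min m d) * r := by
    refine dvd_of_eval_eq_zero hab ha0 (m := m) (hpd.sub ?_) ?_
    · have := (hWd _ hle).mul hrd
      rwa [show min m d + (m - d) = m by omega] at this
    · rw [map_sub, map_mul, hWh _ hle, hr, hq, sub_self]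
  have := Ideal.add_mem _ (Ideal.mem_of_dvd _ hdiff hF) (Ideal.mul_mem_right r _ (hWJ _ hle))
  rwa [sub_add_cancel] at this

end ReesAlgebra


theorem isUnit_of_le_span_singleton {R : Type*} [CommRing R] [IsNoetherianRing R] {I : Ideal R}
    (hI : I.heightOf = 2) {d : R} (hd : I ≤ Ideal.span {d}) : IsUnit d := by
  by_contra hu
  have hne : Ideal.span {d} ≠ ⊤ := by rwa [Ne, Ideal.span_singleton_eq_top]
  obtain ⟨p, hp⟩ := Ideal.nonempty_minimalPrimes hne
  have hpp : p.IsPrime := hp.isPrime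
  have h1 := Ideal.height_le_one_of_isPrincipal_of_mem_minimalPrimes _ p hp
  have h2 : I.heightOf ≤ Order.height (⟨p, hpp⟩ : PrimeSpectrum R) :=
    iInf₂_le (⟨p, hpp⟩ : PrimeSpectrum R) (hd.trans hp.le)
  rw [← PrimeSpectrum.height_eq_orderHeight, hI] at h2
  have h3 : (2 : ℕ∞) ≤ 1 := h2.trans h1
  exact absurd h3 (by decide)

theorem eq_sum_C_mul_X_of_mem_span {σ k : Type*} [Fintype σ] [Field k] {p : MvPolynomial σ k}
    (hp : p ∈ Submodule.span k (Set.range (X : σ → MvPolynomial σ k))) :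
    p = ∑ i, C (coeff (Finsupp.single i 1) p) * X i := by
  classical
  induction hp using Submodule.span_induction with
  | mem q hq =>
    obtain ⟨j, rfl⟩ := hq
    simp [coeff_X, Finsupp.single_left_inj]
  | zero => simp
  | add p q _ _ hp hq =>
    conv_lhs => rw [hp, hq]
    simp [add_mul, Finset.sum_add_distrib]
  | smul r p _ hp =>
    conv_lhs => rw [hp]
    simp [Finset.smul_sum, smul_eq_C_mul, mul_assoc]

/-- The iterated Sylvester forms of `a s + b t` and `c s + d t`, where `c = x s² + y s t + z t²` and
`d = u s² + v s t + w t²`, indexed by their degree in `s, t`. -/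
noncomputable def sylvesterForm {A : Type*} [CommRing A] (a b x y z u v w : A) :
    ℕ → MvPolynomial (Fin 2) A
  | 0 => C (-(b ^ 3 * x) + a * b ^ 2 * y - a ^ 2 * b * z + a * b ^ 2 * u
          - a ^ 2 * b * v + a ^ 3 * w)
  | 1 => C (b ^ 2 * x - a * b * u) * X 0 +
          C (b ^ 2 * y - a * b * z - a * b * v + a ^ 2 * w) * X 1
  | 2 => C a * (C u * X 0 ^ 2 + C v * (X 0 * X 1) + C w * X 1 ^ 2) -
          C b * (C x * X 0 ^ 2 + C y * (X 0 * X 1) + C z * X 1 ^ 2)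
  | _ => (C x * X 0 ^ 2 + C y * (X 0 * X 1) + C z * X 1 ^ 2) * X 0 +
          (C u * X 0 ^ 2 + C v * (X 0 * X 1) + C w * X 1 ^ 2) * X 1

theorem isHomogeneous_binary_quadratic {A : Type*} [CommRing A] (x y z : A) :
    (C x * X 0 ^ 2 + C y * (X 0 * X 1) + C z * X 1 ^ 2 :
      MvPolynomial (Fin 2) A).IsHomogeneous 2 :=
  ((isHomogeneous_C_mul_X_pow _ _ _).add
    (((isHomogeneous_X _ _).mul (isHomogeneous_X _ _)).C_mul _)).add
    (isHomogeneous_C_mul_X_pow _ _ _)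

theorem isHomogeneous_sylvesterForm {A : Type*} [CommRing A] (a b x y z u v w : A) {j : ℕ}
    (hj : j ≤ 3) : (sylvesterForm a b x y z u v w j).IsHomogeneous j := by
  interval_cases j
  · exact isHomogeneous_C _ _
  · exact (isHomogeneous_C_mul_X _ _).add (isHomogeneous_C_mul_X _ _)
  · exact ((isHomogeneous_binary_quadratic u v w).C_mul a).sub
      ((isHomogeneous_binary_quadratic x y z).C_mul b)
  · exact ((isHomogeneous_binary_quadratic x y z).mul (isHomogeneous_X _ _)).add
      ((isHomogeneous_binary_quadratic u v w).mul (isHomogeneous_X _ _))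

theorem eval_sylvesterForm {A : Type*} [CommRing A] (a b x y z u v w : A) {j : ℕ}
    (hj : j ≤ 3) : eval ![-b, a] (sylvesterForm a b x y z u v w j) =
      -(b ^ 3 * x) + a * b ^ 2 * y - a ^ 2 * b * z + a * b ^ 2 * u
          - a ^ 2 * b * v + a ^ 3 * w := by
  interval_cases j <;> simp [sylvesterForm] <;> ring

section Transfer

variable {k : Type*} [Field k]

/-- The identification of `k[T₁,T₂,T₃][s,t]` with `k[s,t,T₁,T₂,T₃]`. -/
noncomputable def flattenHom (k : Type*) [Field k] :
    MvPolynomial (Fin 2) (MvPolynomial (Fin 3) k) →+* MvPolynomial (Fin 5) k :=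
  eval₂Hom (toFive k).toRingHom ![X 0, X 1]

theorem flattenHom_surjective : Function.Surjective (flattenHom k) := by
  intro p
  refine ⟨aeval (R := k) ![X 0, X 1, C (X 0), C (X 1), C (X 2)] p, ?_⟩
  have : (flattenHom k).comp (aeval (R := k) ![X 0, X 1, C (X 0), C (X 1), C (X 2)] :
      MvPolynomial (Fin 5) k →ₐ[k] MvPolynomial (Fin 2) (MvPolynomial (Fin 3) k)).toRingHom =
      RingHom.id _ := by
    refine ringHom_ext (fun r => ?_) fun i => ?_
    · simp [flattenHom, toFive, MvPolynomial.algebraMap_apply, algebraMap_eq]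
    · fin_cases i <;> simp [flattenHom, toFive]
  exact congrArg (fun F => F p) this

theorem reesPresentation_toFive (f : Fin 3 → MvPolynomial (Fin 2) k) (p : MvPolynomial (Fin 3) k) :
    reesPresentation k f (toFive k p) = reesHom f p := by
  have : (reesPresentation k f).comp (toFive k) = reesHom f := by
    refine algHom_ext fun i => ?_
    fin_cases i <;> simp [reesPresentation, toFive, reesHom, Polynomial.X_mul_C]
  exact congrArg (fun F => F p) this

theorem reesPresentation_flattenHom (f : Fin 3 → MvPolynomial (Fin 2) k)
    (θ : MvPolynomial (Fin 2) (MvPolynomial (Fin 3) k)) :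
    reesPresentation k f (flattenHom k θ) = reesHomIterated f θ := by
  have : (reesPresentation k f).toRingHom.comp (flattenHom k) = reesHomIterated f := by
    refine ringHom_ext (fun r => ?_) fun i => ?_
    · simp [flattenHom, reesHomIterated, reesPresentation_toFive]
    · fin_cases i <;> simp [flattenHom, reesHomIterated, reesPresentation]
  exact congrArg (fun F => F θ) this

theorem coordHom_sum (α β γ p : Fin 3 → k) :
    coordHom α β γ (∑ i, C (p i) * X i) =
      Polynomial.C (C (∑ i, p i * α i) * X 1 - C (∑ i, p i * β i) * X 0) +
        Polynomial.X * Polynomial.C (C (∑ i, p i * γ i)) := by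
  simp [coordHom, Fin.sum_univ_three, Polynomial.algebraMap_apply, algebraMap_eq]
  ring

theorem aeval_sum_C_mul_X (f : Fin 3 → MvPolynomial (Fin 2) k) (p : Fin 3 → k) :
    aeval f (∑ i, C (p i) * X i) = ∑ i, C (p i) * f i := by
  simp [algebraMap_eq]

theorem reesHom_sum_C_mul_X (f : Fin 3 → MvPolynomial (Fin 2) k) (p : Fin 3 → k) :
    reesHom f (∑ i, C (p i) * X i) =
      Polynomial.X * Polynomial.C (aeval f (∑ i, C (p i) * X i)) := by
  simp only [reesHom, map_sum, map_mul, aeval_X, aeval_C, algebraMap_eq, Polynomial.algebraMap_apply,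
    Finset.mul_sum]
  exact Finset.sum_congr rfl fun i _ => by ring

end Transfer

section DualBasis

variable {k : Type*} [Field k] {p q : Fin 3 → k} {G f : Fin 3 → MvPolynomial (Fin 2) k}

theorem exists_cross_ne_zero
    (hf : f = ![(C (p 1) * X 0 + C (q 1) * X 1) * G 2 - (C (p 2) * X 0 + C (q 2) * X 1) * G 1,
      (C (p 2) * X 0 + C (q 2) * X 1) * G 0 - (C (p 0) * X 0 + C (q 0) * X 1) * G 2,
      (C (p 0) * X 0 + C (q 0) * X 1) * G 1 - (C (p 1) * X 0 + C (q 1) * X 1) * G 0])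
    (hunit : ∀ d, (∀ i, d ∣ f i) → IsUnit d) :
    ∃ c : Fin 3 → k, c 0 * (p 1 * q 2 - p 2 * q 1) + c 1 * (p 2 * q 0 - p 0 * q 2) +
      c 2 * (p 0 * q 1 - p 1 * q 0) = 1 := by
  by_contra! hc
  have h0 : p 1 * q 2 - p 2 * q 1 = 0 := by
    by_contra h
    exact hc ![(p 1 * q 2 - p 2 * q 1)⁻¹, 0, 0] (by simp [h])
  have h1 : p 2 * q 0 - p 0 * q 2 = 0 := by
    by_contra h
    exact hc ![0, (p 2 * q 0 - p 0 * q 2)⁻¹, 0] (by simp [h])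
  have h2 : p 0 * q 1 - p 1 * q 0 = 0 := by
    by_contra h
    exact hc ![0, 0, (p 0 * q 1 - p 1 * q 0)⁻¹] (by simp [h])
  obtain ⟨l, hl, hdvd⟩ : ∃ l : MvPolynomial (Fin 2) k, constantCoeff l = 0 ∧
      ∀ i, l ∣ C (p i) * X 0 + C (q i) * X 1 := by
    by_cases hq : q = 0
    · exact ⟨X 0, by simp, fun i => by simp [hq]⟩
    · obtain ⟨j, hj⟩ := Function.ne_iff.1 hq
      replace hj : q j ≠ 0 := hj
      refine ⟨C (p j / q j) * X 0 + X 1, by simp, fun i => ⟨C (q i), ?_⟩⟩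
      have : p i = p j / q j * q i := by
        have : p i * q j = p j * q i := by
          fin_cases i <;> fin_cases j <;> simp <;>
            first | ring1 | linear_combination h0 | linear_combination -h0 | linear_combination h1 |
              linear_combination -h1 | linear_combination h2 | linear_combination -h2
        field_simp
        exact this
      rw [this, C_mul]
      ring
  have hlu : IsUnit l := by
    refine hunit l fun i => ?_
    fin_cases i <;> simp only [hf] <;> exact dvd_sub ((hdvd _).mul_right _) ((hdvd _).mul_right _)
  have := hlu.map (constantCoeff (R := k) (σ := Fin 2))
  simp [hl] at this

/-- If `f = (p s + q t) × G` has no common divisor, then `p, q` extend to a basis of `k³` of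
determinant one; with respect to the dual basis `α, β, γ` the forms `f` are given by two forms
`P, Q`. -/
theorem exists_dual_basis
    (hf : f = ![(C (p 1) * X 0 + C (q 1) * X 1) * G 2 - (C (p 2) * X 0 + C (q 2) * X 1) * G 1,
      (C (p 2) * X 0 + C (q 2) * X 1) * G 0 - (C (p 0) * X 0 + C (q 0) * X 1) * G 2,
      (C (p 0) * X 0 + C (q 0) * X 1) * G 1 - (C (p 1) * X 0 + C (q 1) * X 1) * G 0])
    (hunit : ∀ d, (∀ i, d ∣ f i) → IsUnit d) :
    ∃ α β γ c : Fin 3 → k,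
      (∀ i j, α i * p j + β i * q j + γ i * c j = if i = j then 1 else 0) ∧
      (∑ i, p i * α i = 1 ∧ ∑ i, p i * β i = 0 ∧ ∑ i, p i * γ i = 0) ∧
      (∑ i, q i * α i = 0 ∧ ∑ i, q i * β i = 1 ∧ ∑ i, q i * γ i = 0) ∧
      ∀ i, f i = (∑ j, C (γ j) * G j) * (C (α i) * X 1 - C (β i) * X 0) +
        (∑ j, (C (β j) * X 0 - C (α j) * X 1) * G j) * C (γ i) := by
  obtain ⟨c, hc⟩ := exists_cross_ne_zero hf hunit
  have hC := congrArg (C (σ := Fin 2)) hc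
  simp only [C_add, C_mul, C_sub, C_1] at hC
  refine ⟨![q 1 * c 2 - q 2 * c 1, q 2 * c 0 - q 0 * c 2, q 0 * c 1 - q 1 * c 0],
    ![c 1 * p 2 - c 2 * p 1, c 2 * p 0 - c 0 * p 2, c 0 * p 1 - c 1 * p 0],
    ![p 1 * q 2 - p 2 * q 1, p 2 * q 0 - p 0 * q 2, p 0 * q 1 - p 1 * q 0], c, ?_, ?_, ?_, ?_⟩
  · intro i j
    fin_cases i <;> fin_cases j <;> simp <;> first | ring1 | linear_combination hc
  · refine ⟨?_, ?_, ?_⟩ <;> simp [Fin.sum_univ_three] <;> first | ring1 | linear_combination hc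
  · refine ⟨?_, ?_, ?_⟩ <;> simp [Fin.sum_univ_three] <;> first | ring1 | linear_combination hc
  · intro i
    fin_cases i <;> simp only [hf, Fin.sum_univ_three] <;> simp
    · linear_combination (-((C (p 1) * X 0 + C (q 1) * X 1) * G 2 -
        (C (p 2) * X 0 + C (q 2) * X 1) * G 1)) * hC
    · linear_combination (-((C (p 2) * X 0 + C (q 2) * X 1) * G 0 -
        (C (p 0) * X 0 + C (q 0) * X 1) * G 2)) * hC
    · linear_combination (-((C (p 0) * X 0 + C (q 0) * X 1) * G 1 -
        (C (p 1) * X 0 + C (q 1) * X 1) * G 0)) * hC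

end DualBasis

section NonbalancedQuartics

variable {k : Type*} [Field k]

/-- The cubic column of the Hilbert–Burch matrix of the form
`(x s² + y s t + z t²) s + (u s² + v s t + w t²) t`. -/
noncomputable def cubicColumn (x y z u v w : Fin 3 → k) (i : Fin 3) : MvPolynomial (Fin 2) k :=
  C (x i) * X 0 ^ 3 + C (y i + u i) * (X 0 ^ 2 * X 1) + C (z i + v i) * (X 0 * X 1 ^ 2) +
    C (w i) * X 1 ^ 3

theorem isHomogeneous_cubicColumn (x y z u v w : Fin 3 → k) (i : Fin 3) :
    (cubicColumn x y z u v w i).IsHomogeneous 3 :=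
  (((isHomogeneous_C_mul_X_pow _ _ _).add
    (((isHomogeneous_X_pow _ 2).mul (isHomogeneous_X _ _)).C_mul _)).add
    (((isHomogeneous_X _ _).mul (isHomogeneous_X_pow _ 2)).C_mul _)).add
    (isHomogeneous_C_mul_X_pow _ _ _)

/-- Defining ideal of the Rees algebra and implicit equation for three coprime quartic forms with a
linear syzygy, in terms of the coefficients of the linear forms involved. -/
theorem ker_rees_of_linear_syzygy {p q x y z u v w : Fin 3 → k}
    {f : Fin 3 → MvPolynomial (Fin 2) k} {a b x' y' z' u' v' w' : MvPolynomial (Fin 3) k}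
    (ha : a = ∑ i, C (p i) * X i) (hb : b = ∑ i, C (q i) * X i)
    (hx : x' = ∑ i, C (x i) * X i) (hy : y' = ∑ i, C (y i) * X i)
    (hz : z' = ∑ i, C (z i) * X i) (hu : u' = ∑ i, C (u i) * X i)
    (hv : v' = ∑ i, C (v i) * X i) (hw : w' = ∑ i, C (w i) * X i)
    (hf : f = ![
      (C (p 1) * X 0 + C (q 1) * X 1) * cubicColumn x y z u v w 2 -
        (C (p 2) * X 0 + C (q 2) * X 1) * cubicColumn x y z u v w 1,
      (C (p 2) * X 0 + C (q 2) * X 1) * cubicColumn x y z u v w 0 -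
        (C (p 0) * X 0 + C (q 0) * X 1) * cubicColumn x y z u v w 2,
      (C (p 0) * X 0 + C (q 0) * X 1) * cubicColumn x y z u v w 1 -
        (C (p 1) * X 0 + C (q 1) * X 1) * cubicColumn x y z u v w 0])
    (hunit : ∀ d, (∀ i, d ∣ f i) → IsUnit d) :
    RingHom.ker (reesPresentation k f) = Ideal.span {
        toFive k a * X 0 + toFive k b * X 1,
        flattenHom k (sylvesterForm a b x' y' z' u' v' w' 3),
        flattenHom k (sylvesterForm a b x' y' z' u' v' w' 2),
        flattenHom k (sylvesterForm a b x' y' z' u' v' w' 1),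
        flattenHom k (sylvesterForm a b x' y' z' u' v' w' 0)} ∧
      RingHom.ker (aeval f : MvPolynomial (Fin 3) k →ₐ[k] MvPolynomial (Fin 2) k) =
        Ideal.span {-(b ^ 3 * x') + a * b ^ 2 * y' - a ^ 2 * b * z' + a * b ^ 2 * u'
          - a ^ 2 * b * v' + a ^ 3 * w'} := by
  obtain ⟨α, β, γ, c, hinv, ⟨hpα, hpβ, hpγ⟩, ⟨hqα, hqβ, hqγ⟩, hfeq⟩ := exists_dual_basis hf hunit
  set G := cubicColumn x y z u v w with hG
  set P := ∑ j, C (γ j) * G j with hP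
  set Q := ∑ j, (C (β j) * X 0 - C (α j) * X 1) * G j with hQ
  set h := -(b ^ 3 * x') + a * b ^ 2 * y' - a ^ 2 * b * z' + a * b ^ 2 * u'
          - a ^ 2 * b * v' + a ^ 3 * w' with hh
  have hX : ∀ i, X i = C (α i) * a + C (β i) * b + C (γ i) * ∑ j, C (c j) * X j := by
    intro i
    have : ∀ j, C (α i) * C (p j) + C (β i) * C (q j) + C (γ i) * C (c j) =
        if i = j then (1 : MvPolynomial (Fin 3) k) else 0 := by
      intro j
      rw [← C_mul, ← C_mul, ← C_mul, ← C_add, ← C_add, hinv]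
      split_ifs <;> simp
    calc X i = ∑ j, (if i = j then (1 : MvPolynomial (Fin 3) k) else 0) * X j := by simp
      _ = _ := by
        simp only [← this, ha, hb, Finset.mul_sum, ← Finset.sum_add_distrib]
        exact Finset.sum_congr rfl fun j _ => by ring
  have hca : coordHom α β γ a = Polynomial.C (X 1) := by
    rw [ha, coordHom_sum, hpα, hpβ, hpγ]; simp
  have hcb : coordHom α β γ b = -Polynomial.C (X 0 : MvPolynomial (Fin 2) k) := by
    rw [hb, coordHom_sum, hqα, hqβ, hqγ]; simp
  have hch : coordHom α β γ h = Polynomial.X * Polynomial.C P - Polynomial.C Q := by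
    have hlin : ∀ r : Fin 3 → k, coordHom α β γ (∑ i, C (r i) * X i) =
        ∑ i, Polynomial.C (C (r i)) * (Polynomial.C (C (α i)) * Polynomial.C (X 1) -
          Polynomial.C (C (β i)) * Polynomial.C (X 0) + Polynomial.X * Polynomial.C (C (γ i))) := by
      intro r
      simp [coordHom, Polynomial.algebraMap_apply, algebraMap_eq]
    rw [hh]
    simp only [map_add, map_sub, map_neg, map_mul, map_pow, hca, hcb]
    rw [hx, hy, hz, hu, hv, hw]
    simp only [hlin]
    simp only [hP, hQ, hG, cubicColumn, Fin.sum_univ_three, C_add, Polynomial.C_add,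
      Polynomial.C_sub, Polynomial.C_mul, Polynomial.C_pow]
    ring
  have hPd : P.IsHomogeneous 3 :=
    .sum _ _ _ fun j _ => (isHomogeneous_cubicColumn x y z u v w j).C_mul _
  have hQd : Q.IsHomogeneous 4 := by
    refine .sum _ _ _ fun j _ => ?_
    exact ((isHomogeneous_C_mul_X _ _).sub (isHomogeneous_C_mul_X _ _)).mul
      (isHomogeneous_cubicColumn x y z u v w j)
  have hPQ : IsRelPrime P Q := fun d h0 h1 => hunit d fun i => by
    rw [hfeq]
    exact dvd_add (h0.mul_right _) (h1.mul_right _)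
  have hP0 : P ≠ 0 := by
    intro hP0
    have hQu : IsUnit Q := hPQ (hP0 ▸ dvd_zero Q) dvd_rfl
    have := hQu.map (constantCoeff (R := k) (σ := Fin 2))
    rw [constantCoeff_eq, hQd.coeff_eq_zero (by simp)] at this
    exact not_isUnit_zero this
  have hfd : ∀ i, (f i).IsHomogeneous 4 := by
    intro i
    rw [hfeq]
    refine (hPd.mul ((isHomogeneous_C_mul_X (R := k) (α i) 1).sub
      (isHomogeneous_C_mul_X (β i) 0))).add ?_
    simpa using hQd.mul (isHomogeneous_C _ (γ i))
  have hfa : aeval f a = X 1 * P := by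
    have h1 : aeval f a = (C (∑ i, p i * α i) * X 1 - C (∑ i, p i * β i) * X 0) * P +
        Q * C (∑ i, p i * γ i) := by
      rw [ha, aeval_sum_C_mul_X]
      simp only [hfeq, Fin.sum_univ_three, C_add, C_mul]
      ring
    rw [h1, hpα, hpβ, hpγ]; simp
  have hfb : aeval f b = -(X 0 * P) := by
    have h1 : aeval f b = (C (∑ i, q i * α i) * X 1 - C (∑ i, q i * β i) * X 0) * P +
        Q * C (∑ i, q i * γ i) := by
      rw [hb, aeval_sum_C_mul_X]
      simp only [hfeq, Fin.sum_univ_three, C_add, C_mul]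
      ring
    rw [h1, hqα, hqβ, hqγ]; simp
  have hsyz : aeval f x' * X 0 ^ 3 + (aeval f y' + aeval f u') * (X 0 ^ 2 * X 1) +
      (aeval f z' + aeval f v') * (X 0 * X 1 ^ 2) + aeval f w' * X 1 ^ 3 = 0 := by
    have h1 : ∑ i, G i * f i = 0 := by
      rw [hf]
      simp [Fin.sum_univ_three]
      ring
    rw [← h1, hx, hy, hz, hu, hv, hw]
    simp only [aeval_sum_C_mul_X]
    simp only [Fin.sum_univ_three, hG, cubicColumn, C_add]
    ring
  have hfh : aeval f h = 0 := by
    rw [hh]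
    simp only [map_add, map_sub, map_neg, map_mul, map_pow, hfa, hfb]
    linear_combination P ^ 3 * hsyz
  have hsyz' := congrArg Polynomial.C hsyz
  simp only [Polynomial.C_add, Polynomial.C_mul, Polynomial.C_pow, Polynomial.C_0] at hsyz'
  have hra : reesHom f a = Polynomial.X * Polynomial.C P * Polynomial.C (X 1) := by
    conv_lhs => rw [ha, reesHom_sum_C_mul_X, ← ha, hfa, Polynomial.C_mul]
    ring
  have hrb : reesHom f b = -(Polynomial.X * Polynomial.C P * Polynomial.C (X 0)) := by
    conv_lhs => rw [hb, reesHom_sum_C_mul_X, ← hb, hfb, Polynomial.C_neg, Polynomial.C_mul]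
    ring
  have hrlin : ∀ {r : Fin 3 → k} {r' : MvPolynomial (Fin 3) k}, r' = ∑ i, C (r i) * X i →
      reesHom f r' = Polynomial.X * Polynomial.C (aeval f r') := by
    rintro r _ rfl
    exact reesHom_sum_C_mul_X f r
  constructor
  · apply le_antisymm
    · intro θ hθ
      obtain ⟨θ, rfl⟩ := flattenHom_surjective θ
      rw [RingHom.mem_ker, reesPresentation_flattenHom] at hθ
      rw [← Ideal.mem_comap]
      refine mem_of_reesHomIterated_eq_zero hX hca hcb hPQ hP0
        hPd hQd hch hfeq hra hrb ?_ (sylvesterForm a b x' y' z' u' v' w') ?_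
        (fun j => isHomogeneous_sylvesterForm _ _ _ _ _ _ _ _)
        (fun j => eval_sylvesterForm _ _ _ _ _ _ _ _) hθ
      · rw [Ideal.mem_comap]
        apply Ideal.subset_span
        simp [flattenHom]
      · intro j hj
        rw [Ideal.mem_comap]
        apply Ideal.subset_span
        interval_cases j <;> simp
    · rw [Ideal.span_le]
      rintro _ (rfl | rfl | rfl | rfl | rfl) <;>
        simp only [SetLike.mem_coe, RingHom.mem_ker, reesPresentation_flattenHom]
      · simp only [map_add, map_mul, reesPresentation_toFive, hra, hrb]
        simp [reesPresentation]
        ring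
      all_goals
        simp only [sylvesterForm, reesHomIterated, coe_eval₂Hom, eval₂_C, eval₂_X, map_add,
          map_sub, map_neg, map_mul, map_pow, hra, hrb,
          hrlin hx, hrlin hy, hrlin hz, hrlin hu, hrlin hv, hrlin hw, RingHom.coe_coe]
      · linear_combination Polynomial.X * hsyz'
      · linear_combination Polynomial.X ^ 2 * Polynomial.C P * hsyz'
      · linear_combination Polynomial.X ^ 3 * Polynomial.C P ^ 2 * hsyz'
      · linear_combination Polynomial.X ^ 4 * Polynomial.C P ^ 3 * hsyz'
  · apply le_antisymm
    · intro r hr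
      rw [Ideal.mem_span_singleton]
      exact dvd_of_aeval_eq_zero hX hPQ hP0 hch (by norm_num : 0 < 4) hfd hfeq hr
    · rw [Ideal.span_singleton_le_iff_mem]
      exact hfh

end NonbalancedQuartics

/-- non-balanced degree-4 case. Let `k` be an infinite field,
`R = k[s,t]`, and `I ⊂ R` a height-2 ideal minimally generated by three forms of degree 4
whose Hilbert–Burch matrix has columns of degrees 1 and 3.  In `S = R[T₁,T₂,T₃]` write the
defining equations of `Sym(I)` as `f = as + bt` and `g = cs + dt` with `a, b` `k`-linear
forms in the `Tᵢ` and `c = xs² + yst + zt²`, `d = us² + vst + wt²` with `x,…,w` `k`-linear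
forms in the `Tᵢ`.  Set `h₁ = ad − bc`, `h₂ = (b²x − abu)s + (b²y − abz − abv + a²w)t` and
`h₃ = −b³x + ab²y − a²bz + ab²u − a²bv + a³w`.  Then the defining ideal of the Rees
algebra `R[It]` in `S` equals `(f, g, h₁, h₂, h₃)`, and `h₃` is the elimination
equation. -/
theorem rees_defining_ideal_deg4_nonbalanced
    (k : Type*) [Field k] [Infinite k]
    (a b x y z u v w : MvPolynomial (Fin 3) k)
    (hlin : ∀ p ∈ ({a, b, x, y, z, u, v, w} : Set (MvPolynomial (Fin 3) k)),
      p ∈ Submodule.span k (Set.range (X : Fin 3 → MvPolynomial (Fin 3) k)))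
    (φ : Matrix (Fin 3) (Fin 2) (MvPolynomial (Fin 2) k))
    (hφ1 : ∀ i, φ i 0 =
      C (coeff (Finsupp.single i 1) a) * X 0 + C (coeff (Finsupp.single i 1) b) * X 1)
    (hφ2 : ∀ i, φ i 1 =
      C (coeff (Finsupp.single i 1) x) * X 0 ^ 3 +
      C (coeff (Finsupp.single i 1) y + coeff (Finsupp.single i 1) u) * (X 0 ^ 2 * X 1) +
      C (coeff (Finsupp.single i 1) z + coeff (Finsupp.single i 1) v) * (X 0 * X 1 ^ 2) +
      C (coeff (Finsupp.single i 1) w) * X 1 ^ 3)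
    (f : Fin 3 → MvPolynomial (Fin 2) k)
    (hf : ∀ j, f j = (-1) ^ (j : ℕ) * (φ.submatrix j.succAbove id).det)
    (I : Ideal (MvPolynomial (Fin 2) k)) (hI : I = Ideal.span (Set.range f))
    (hht : I.heightOf = 2)
    (hmin : ¬ ∃ g₁ g₂ : MvPolynomial (Fin 2) k, I = Ideal.span {g₁, g₂}) :
    (RingHom.ker (reesPresentation k f) =
      Ideal.span {
        toFive k a * X 0 + toFive k b * X 1,
        (toFive k x * X 0 ^ 2 + toFive k y * (X 0 * X 1) + toFive k z * X 1 ^ 2) * X 0 +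
          (toFive k u * X 0 ^ 2 + toFive k v * (X 0 * X 1) + toFive k w * X 1 ^ 2) * X 1,
        toFive k a *
            (toFive k u * X 0 ^ 2 + toFive k v * (X 0 * X 1) + toFive k w * X 1 ^ 2) -
          toFive k b *
            (toFive k x * X 0 ^ 2 + toFive k y * (X 0 * X 1) + toFive k z * X 1 ^ 2),
        toFive k (b ^ 2 * x - a * b * u) * X 0 +
          toFive k (b ^ 2 * y - a * b * z - a * b * v + a ^ 2 * w) * X 1,
        toFive k (-(b ^ 3 * x) + a * b ^ 2 * y - a ^ 2 * b * z + a * b ^ 2 * u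
          - a ^ 2 * b * v + a ^ 3 * w)}) ∧
      RingHom.ker (MvPolynomial.aeval f : MvPolynomial (Fin 3) k →ₐ[k] MvPolynomial (Fin 2) k) =
        Ideal.span {-(b ^ 3 * x) + a * b ^ 2 * y - a ^ 2 * b * z + a * b ^ 2 * u
          - a ^ 2 * b * v + a ^ 3 * w} := by
  have ha := eq_sum_C_mul_X_of_mem_span (hlin a (by simp))
  have hb := eq_sum_C_mul_X_of_mem_span (hlin b (by simp))
  have hx := eq_sum_C_mul_X_of_mem_span (hlin x (by simp))
  have hy := eq_sum_C_mul_X_of_mem_span (hlin y (by simp))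
  have hz := eq_sum_C_mul_X_of_mem_span (hlin z (by simp))
  have hu := eq_sum_C_mul_X_of_mem_span (hlin u (by simp))
  have hv := eq_sum_C_mul_X_of_mem_span (hlin v (by simp))
  have hw := eq_sum_C_mul_X_of_mem_span (hlin w (by simp))
  have hunit : ∀ d, (∀ i, d ∣ f i) → IsUnit d := by
    intro d hd
    refine isUnit_of_le_span_singleton hht ?_
    rw [hI, Ideal.span_le]
    rintro _ ⟨i, rfl⟩
    exact Ideal.mem_span_singleton.2 (hd i)
  convert ker_rees_of_linear_syzygy ha hb hx hy hz hu hv hw ?_ hunit using 3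
  · simp [sylvesterForm, flattenHom]
  · funext j
    rw [hf, Matrix.det_fin_two]
    fin_cases j <;> simp [Fin.succAbove, hφ1, hφ2, cubicColumn] <;> ring
end
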